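/- arXiv:math/0701351 — 4 statements merged into one kernel-verified Lean document; each statement's English description precedes it below -/
import Mathlib

section
/- Let d be a squarefree negative integer and K = ℚ(√d). Then the quaternion algebra ℍ(K) = (−1,−1/K) is a division ring if and only if d ≡ 1 (mod 8). -/
open Quaternion
theorem seven_aux (m : ℤ) (hm : m % 8 = 7) : ∀ (k : ℕ) (n x y z : ℤ), n.natAbs ≤ k → n ≠ 0 →
    x^2+y^2+z^2 = m*n^2 → False := by
  intro k
  induction k with
  | zero => intro n x y z h hn; omega
  | succ k ih =>
    intro n x y z h hn e
    have sq4 : ∀ w : ℤ, (w % 2 = 0 ∧ w^2 % 4 = 0) ∨ (w % 2 = 1 ∧ w^2 % 4 = 1) := by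
      intro w
      have : w % 4 = 0 ∨ w % 4 = 1 ∨ w % 4 = 2 ∨ w % 4 = 3 := by omega
      rcases this with h | h | h | h <;> simp [pow_two, Int.mul_emod, h] <;> omega
    have sq8 : ∀ w : ℤ, w^2 % 8 = 0 ∨ w^2 % 8 = 1 ∨ w^2 % 8 = 4 := by
      intro w
      have : w % 8 = 0 ∨ w % 8 = 1 ∨ w % 8 = 2 ∨ w % 8 = 3 ∨ w % 8 = 4 ∨ w % 8 = 5 ∨ w % 8 = 6 ∨ w % 8 = 7 := by omega
      rcases this with h | h | h | h | h | h | h | h <;> simp [pow_two, Int.mul_emod, h]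
    have e8 : (x^2+y^2+z^2) % 8 = (7 * (n^2 % 8)) % 8 := by
      rw [e, Int.mul_emod, hm]
    rcases sq4 n with ⟨hn2, hn4⟩ | ⟨hn2, hn4⟩
    · rcases sq4 x with ⟨hx, hx4⟩ | ⟨hx, hx4⟩ <;> rcases sq4 y with ⟨hy, hy4⟩ | ⟨hy, hy4⟩ <;>
        rcases sq4 z with ⟨hz, hz4⟩ | ⟨hz, hz4⟩ <;> try omega
      obtain ⟨n', rfl⟩ := Int.dvd_of_emod_eq_zero hn2
      obtain ⟨x', rfl⟩ := Int.dvd_of_emod_eq_zero hx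
      obtain ⟨y', rfl⟩ := Int.dvd_of_emod_eq_zero hy
      obtain ⟨z', rfl⟩ := Int.dvd_of_emod_eq_zero hz
      exact ih n' x' y' z' (by omega) (by omega) (by linarith)
    · have := sq8 x
      have := sq8 y
      have := sq8 z
      have := sq8 n
      omega

theorem seven_rat (m : ℤ) (hm : m % 8 = 7) (n x y z : ℚ) (hn : n ≠ 0)
    (e : x^2+y^2+z^2 = m*n^2) : False := by
  have key : ∀ w : ℚ, ∃ (D : ℤ), D ≠ 0 ∧ ∃ a : ℤ, (a:ℚ) = D * w := fun w =>
    ⟨w.den, by exact_mod_cast w.den_ne_zero, w.num, by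
      have := Rat.mul_den_eq_num w
      push_cast; linarith⟩
  obtain ⟨a, ha, n', hn'⟩ := key n
  obtain ⟨b, hb, x', hx'⟩ := key x
  obtain ⟨c, hc, y', hy'⟩ := key y
  obtain ⟨f, hf, z', hz'⟩ := key z
  have hn0 : n' ≠ 0 := by
    rintro rfl
    have : (a:ℚ) ≠ 0 := by exact_mod_cast ha
    simp_all
  refine seven_aux m hm _ (n'*b*c*f) (x'*a*c*f) (y'*a*b*f) (z'*a*b*c) le_rfl
    (by simp [*]) ?_
  have : ((x'*a*c*f : ℚ))^2+(y'*a*b*f)^2+(z'*a*b*c)^2 = m*(n'*b*c*f)^2 := by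
    rw [hn', hx', hy', hz']
    linear_combination (a*b*c*f)^2*e
  exact_mod_cast this

set_option maxHeartbeats 1000000 in
theorem legendre_aux (m N : ℕ) (hm : 0 < m) (hN : 0 < N) (hc : Nat.Coprime m N)
    (hNs : ¬ IsSquare N) (hmNs : ¬ IsSquare (m*N)) (t s : ℤ)
    (ht : (m:ℤ) ∣ t^2 + N) (hs : (N:ℤ) ∣ s^2 - m) :
    ∃ X Y Z : ℤ, X ≠ 0 ∧ m * X^2 = Y^2 + N * Z^2 := by
  have : NeZero m := ⟨hm.ne'⟩
  have : NeZero N := ⟨hN.ne'⟩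
  let S := (Finset.range (Nat.sqrt N + 1)) ×ˢ (Finset.range (Nat.sqrt (m*N) + 1)) ×ˢ (Finset.range (Nat.sqrt m + 1))
  let f : ℕ × ℕ × ℕ → ZMod m × ZMod N := fun p =>
    ((p.2.1 : ZMod m) - (t : ZMod m) * p.2.2, (p.2.1 : ZMod N) - (s : ZMod N) * p.1)
  have hcard : (Finset.univ : Finset (ZMod m × ZMod N)).card < S.card := by
    simp only [S, Finset.card_product, Finset.card_range, Finset.card_univ, Fintype.card_prod, ZMod.card]
    have h1 := Nat.lt_succ_sqrt' N
    have h2 := Nat.lt_succ_sqrt' (m*N)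
    have h3 := Nat.lt_succ_sqrt' m
    simp only [Nat.succ_eq_add_one] at h1 h2 h3
    by_contra hcon
    push Not at hcon
    have h4 := Nat.pow_le_pow_left hcon 2
    have h5 : (m*N)*(m*N) < (((N.sqrt+1)^2)*((m.sqrt+1)^2)) * ((m*N).sqrt+1)^2 := by
      rw [mul_comm m N] at *
      exact Nat.mul_lt_mul'' (Nat.mul_lt_mul'' h1 h3) h2
    nlinarith
  obtain ⟨p, hp, q, hq, hpq, hf⟩ := Finset.exists_ne_map_eq_of_card_lt_of_maps_to hcard
    (f := f) (fun _ _ => Finset.mem_univ _)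
  obtain ⟨x1, y1, z1⟩ := p
  obtain ⟨x2, y2, z2⟩ := q
  simp only [S, Finset.mem_product, Finset.mem_range, Nat.lt_succ_iff, Nat.le_sqrt'] at hp hq
  simp only [f, Prod.mk.injEq] at hf
  obtain ⟨hf1, hf2⟩ := hf
  have sqb : ∀ (a b c : ℕ), a^2 ≤ c → b^2 ≤ c → ((a:ℤ)-b)^2 ≤ c := by
    intro a b c ha hb
    zify at ha hb
    rcases le_total (a:ℤ) b with h | h <;> nlinarith
  obtain ⟨X, hX⟩ : ∃ X : ℤ, X = (x1:ℤ) - x2 := ⟨_, rfl⟩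
  obtain ⟨Y, hY⟩ : ∃ X : ℤ, X = (y1:ℤ) - y2 := ⟨_, rfl⟩
  obtain ⟨Z, hZ⟩ : ∃ X : ℤ, X = (z1:ℤ) - z2 := ⟨_, rfl⟩
  have bX : X^2 ≤ N := hX ▸ sqb _ _ _ hp.1 hq.1
  have bY : Y^2 ≤ (m*N : ℕ) := hY ▸ sqb _ _ _ hp.2.1 hq.2.1
  have bZ : Z^2 ≤ m := hZ ▸ sqb _ _ _ hp.2.2 hq.2.2
  have nsq : ∀ (a : ℤ) (c : ℕ), ¬ IsSquare c → a^2 ≠ c := by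
    intro a c hc h
    refine hc ⟨a.natAbs, ?_⟩
    zify
    rw [← h, ← sq, sq_abs]
  have bX' : X^2 < N := lt_of_le_of_ne bX (nsq _ _ hNs)
  have bY' : Y^2 < (m*N : ℕ) := lt_of_le_of_ne bY (nsq _ _ hmNs)
  push_cast at bY'
  have hne : ¬ (X = 0 ∧ Y = 0 ∧ Z = 0) := by
    rintro ⟨h1, h2, h3⟩
    apply hpq
    simp only [Prod.mk.injEq]
    omega
  have d1 : (m:ℤ) ∣ Y - t*Z := by
    rw [← ZMod.intCast_zmod_eq_zero_iff_dvd _ m, hY, hZ]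
    push_cast
    linear_combination hf1
  have d2 : (N:ℤ) ∣ Y - s*X := by
    rw [← ZMod.intCast_zmod_eq_zero_iff_dvd _ N, hY, hX]
    push_cast
    linear_combination hf2
  have D1 : (m:ℤ) ∣ Y^2 + N*Z^2 - m*X^2 := by
    obtain ⟨u, hu⟩ := d1
    obtain ⟨v, hv⟩ := ht
    exact ⟨u*(Y+t*Z) + v*Z^2 - X^2, by linear_combination (Y+t*Z)*hu + Z^2*hv⟩
  have D2 : (N:ℤ) ∣ Y^2 + N*Z^2 - m*X^2 := by
    obtain ⟨u, hu⟩ := d2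
    obtain ⟨v, hv⟩ := hs
    exact ⟨u*(Y+s*X) + v*X^2 + Z^2, by linear_combination (Y+s*X)*hu + X^2*hv⟩
  have D : (m*N:ℤ) ∣ Y^2 + N*Z^2 - m*X^2 :=
    IsCoprime.mul_dvd (Nat.isCoprime_iff_coprime.mpr hc) D1 D2
  obtain ⟨w, hw⟩ := D
  have hm' : (0:ℤ) < m := by exact_mod_cast hm
  have hN' : (0:ℤ) < N := by exact_mod_cast hN
  have hmN : (0:ℤ) < m*N := by positivity
  have w1 : w < 2 := by
    by_contra h
    push Not at h
    nlinarith [mul_le_mul_of_nonneg_left h hmN.le, mul_le_mul_of_nonneg_left bZ hN'.le, mul_nonneg hm'.le (sq_nonneg X)]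
  have w2 : -1 < w := by
    by_contra h
    push Not at h
    nlinarith [mul_le_mul_of_nonneg_left h hmN.le, mul_lt_mul_of_pos_left bX' hm', mul_nonneg hN'.le (sq_nonneg Z), sq_nonneg Y]
  have : w = 0 ∨ w = 1 := by omega
  rcases this with rfl | rfl
  · refine ⟨X, Y, Z, ?_, by linarith⟩
    rintro rfl
    have hw' : Y^2 + N*Z^2 = 0 := by linear_combination hw
    have hz : (N:ℤ)*Z^2 = 0 := by linarith [mul_nonneg hN'.le (sq_nonneg Z), sq_nonneg Y]
    have hy : Y^2 = 0 := by linarith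
    have hz' : Z^2 = 0 := (mul_eq_zero.mp hz).resolve_left hN'.ne'
    exact hne ⟨rfl, pow_eq_zero_iff two_ne_zero |>.mp hy, pow_eq_zero_iff two_ne_zero |>.mp hz'⟩
  · refine ⟨X^2+N, Y*X + N*Z, Y - Z*X, by positivity, ?_⟩
    linear_combination (-(X^2+N : ℤ))*hw

theorem not_sq_aux (q k : ℕ) (hq : q.Prime) (hk : ¬ q ∣ k) : ¬ IsSquare (k*q) := by
  rintro ⟨r, hr⟩
  have : q ∣ r * r := ⟨k, by rw [← hr, mul_comm]⟩
  have h1 : q ∣ r := by simpa using hq.dvd_mul.mp this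
  obtain ⟨c, rfl⟩ := h1
  apply hk
  refine ⟨c*c, Nat.eq_of_mul_eq_mul_right hq.pos ?_⟩
  rw [hr]; ring

theorem sqrt_aux (q : ℕ) [Fact q.Prime] (m : ℕ) (h : jacobiSym m q = 1) :
    ∃ s : ℤ, (q:ℤ) ∣ s^2 - m := by
  obtain ⟨r, hr⟩ := ZMod.isSquare_of_jacobiSym_eq_one h
  refine ⟨(r.val : ℤ), ?_⟩
  rw [← ZMod.intCast_zmod_eq_zero_iff_dvd]
  push_cast at hr ⊢
  rw [ZMod.natCast_zmod_val, hr]; ring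

theorem three_sq_of (m N : ℕ) (hm : 0 < m) (hN : 0 < N) (hc : Nat.Coprime m N)
    (hNs : ¬ IsSquare N) (hmNs : ¬ IsSquare (m*N)) (t s : ℤ)
    (ht : (m:ℤ) ∣ t^2 + N) (hs : (N:ℤ) ∣ s^2 - m) (u v : ℕ) (huv : u^2+v^2 = N) :
    ∃ n x y z : ℤ, n ≠ 0 ∧ m * n^2 = x^2+y^2+z^2 := by
  obtain ⟨X, Y, Z, h0, h⟩ := legendre_aux m N hm hN hc hNs hmNs t s ht hs
  refine ⟨X, Y, u*Z, v*Z, h0, ?_⟩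
  rw [h, ← huv]; push_cast; ring

theorem dirichlet_aux (m a k : ℕ) (hm : 0 < k) (ha : Nat.Coprime a k) :
    ∃ q, m < q ∧ q.Prime ∧ q % k = a % k :=
  Nat.forall_exists_prime_gt_and_modEq m hm.ne' ha

theorem case_q (m q : ℕ) (hm : 0 < m) (hq : q.Prime) (hlt : m < q) (hq4 : q % 4 = 1)
    (hmq : (m:ℤ) ∣ q + 1) (hJ : jacobiSym m q = 1) :
    ∃ n x y z : ℤ, n ≠ 0 ∧ m * n^2 = x^2+y^2+z^2 := by
  have := Fact.mk hq
  obtain ⟨s, hs⟩ := sqrt_aux q m hJ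
  obtain ⟨u, v, huv⟩ := Nat.Prime.sq_add_sq (p := q) (by omega)
  have hnd : ¬ q ∣ m := Nat.not_dvd_of_pos_of_lt hm hlt
  exact three_sq_of m q hm hq.pos ((hq.coprime_iff_not_dvd.mpr hnd).symm)
    (by simpa using not_sq_aux q 1 hq (by simpa using hq.one_lt.ne')) (not_sq_aux q m hq hnd) 1 s
    (by simpa [add_comm] using hmq) hs u v huv

theorem mod_dvd (q a k c : ℕ) (h : q % k = a % k) (hc : c ∣ k) : q % c = a % c :=
  Nat.ModEq.of_dvd hc h

theorem jac_aux (m : ℕ) (x : ℤ) (hm : Odd m) (h : (m:ℤ) ∣ x + 1) :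
    jacobiSym x m = ZMod.χ₄ m := by
  rw [jacobiSym.mod_left' (a₂ := -1), jacobiSym.at_neg_one hm]
  rw [Int.emod_eq_emod_iff_emod_sub_eq_zero]
  exact Int.emod_eq_zero_of_dvd (by simpa using h)

theorem three_squares (m : ℕ) (hm : m % 8 = 1 ∨ m % 8 = 2 ∨ m % 8 = 3 ∨ m % 8 = 5 ∨ m % 8 = 6) :
    ∃ n x y z : ℤ, n ≠ 0 ∧ m * n^2 = x^2+y^2+z^2 := by
  have hm0 : 0 < m := by omega
  have hcase : m % 4 = 1 ∨ m % 8 = 3 ∨ m % 4 = 2 := by omega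
  rcases hcase with h | h | h
  · have hcop : Nat.Coprime (2*m-1) (4*m) := by
      have h1 : Nat.Coprime (2*m-1) (2*m) := by
        have := Nat.coprime_self_add_right (m := 2*m-1) (n := 1)
        rw [show 2*m-1+1 = 2*m by omega] at this
        simpa using this
      have h2 : Nat.Coprime (2*m-1) m := Nat.Coprime.coprime_mul_left_right h1
      have h3 : Nat.Coprime (2*m-1) 2 := Nat.Coprime.coprime_mul_right_right h1
      exact Nat.Coprime.mul_right (Nat.Coprime.mul_right (k := 2*m-1) (m := 2) (n := 2) h3 h3) h2
    obtain ⟨q, hlt, hq, hmod⟩ := dirichlet_aux m (2*m-1) (4*m) (by omega) hcop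
    have e4 := mod_dvd _ _ _ 4 hmod ⟨m, rfl⟩
    have em := mod_dvd _ _ _ m hmod ⟨4, by ring⟩
    have q4 : q % 4 = 1 := by omega
    have hd : (m:ℤ) ∣ q + 1 := by
      have h5 : (q:ℤ) ≡ (2*m-1:ℕ) [ZMOD m] := (Int.natCast_modEq_iff).mpr em
      have h6 := h5.symm.dvd
      rw [Nat.cast_sub (by omega)] at h6
      push_cast at h6
      obtain ⟨w, hw⟩ := h6
      exact ⟨w+2, by linear_combination hw⟩
    refine case_q m q hm0 hq hlt q4 hd ?_
    rw [jacobiSym.quadratic_reciprocity_one_mod_four' (Nat.odd_iff.mpr (by omega)) q4]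
    rw [jac_aux m q (Nat.odd_iff.mpr (by omega)) hd, ZMod.χ₄_nat_one_mod_four h]
  · have hcop : Nat.Coprime (m/2) (4*m) := by
      have h2 : Nat.Coprime (m/2) m := by
        have := Nat.coprime_self_add_right (m := m/2) (n := m/2+1)
        rw [show m/2+(m/2+1) = m by omega] at this
        simpa using this
      have h3 : Nat.Coprime (m/2) 2 := Nat.coprime_two_right.mpr (Nat.odd_iff.mpr (by omega))
      exact Nat.Coprime.mul_right (Nat.Coprime.mul_right (k := m/2) (m := 2) (n := 2) h3 h3) h2
    obtain ⟨q, hlt, hq, hmod⟩ := dirichlet_aux m (m/2) (4*m) (by omega) hcop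
    have e4 := mod_dvd _ _ _ 4 hmod ⟨m, rfl⟩
    have em := mod_dvd _ _ _ m hmod ⟨4, by ring⟩
    have q4 : q % 4 = 1 := by omega
    have hd : (m:ℤ) ∣ (2*q : ℤ) + 1 := by
      have h5 : (q:ℤ) ≡ (m/2:ℕ) [ZMOD m] := (Int.natCast_modEq_iff).mpr em
      obtain ⟨w, hw⟩ := h5.symm.dvd
      have h7 : (m:ℤ) = 2*(m/2:ℕ)+1 := by omega
      exact ⟨2*w+1, by linear_combination 2*hw - h7⟩
    have hmo : Odd m := Nat.odd_iff.mpr (by omega)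
    have hJ : jacobiSym m q = 1 := by
      rw [jacobiSym.quadratic_reciprocity_one_mod_four' hmo q4]
      have h8 := jac_aux m (2*q) hmo hd
      rw [jacobiSym.mul_left, jacobiSym.at_two hmo, ZMod.χ₄_nat_three_mod_four (by omega),
        ZMod.χ₈_nat_eq_if_mod_eight, if_neg (by omega), if_neg (by omega)] at h8
      linarith
    have := Fact.mk hq
    obtain ⟨s, hs⟩ := sqrt_aux q m hJ
    obtain ⟨u, v, huv⟩ := Nat.Prime.sq_add_sq (p := q) (by omega)
    have hnd : ¬ q ∣ m := Nat.not_dvd_of_pos_of_lt hm0 hlt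
    have hq2 : ¬ q ∣ 2 := Nat.not_dvd_of_pos_of_lt (by omega) (by omega)
    obtain ⟨s', hs', hodd⟩ : ∃ s' : ℤ, (q:ℤ) ∣ s'^2 - m ∧ s' % 2 = 1 := by
      rcases Int.emod_two_eq_zero_or_one s with h0 | h1
      · refine ⟨s+q, ?_, by omega⟩
        obtain ⟨w, hw⟩ := hs
        exact ⟨w + 2*s+q, by linear_combination hw⟩
      · exact ⟨s, hs, h1⟩
    have hs2 : (2:ℤ) ∣ s'^2 - m := by
      obtain ⟨r, hr⟩ : ∃ r, s' = 2*r+1 := ⟨s'/2, by omega⟩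
      obtain ⟨r', hr'⟩ : ∃ r' : ℤ, (m:ℤ) = 2*r'+1 := ⟨m/2, by omega⟩
      exact ⟨2*r^2+2*r-r', by rw [hr, hr']; ring⟩
    have hsN : ((2*q:ℕ):ℤ) ∣ s'^2 - m := by
      push_cast
      refine IsCoprime.mul_dvd ?_ hs2 hs'
      have : IsCoprime ((2:ℕ):ℤ) (q:ℤ) := Nat.isCoprime_iff_coprime.mpr
        (Nat.coprime_two_left.mpr (Nat.odd_iff.mpr (by omega)))
      simpa using this
    have hmN : ¬ IsSquare (m*(2*q)) := by
      rw [← mul_assoc]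
      exact not_sq_aux q (m*2) hq (fun h => (hq.dvd_mul.mp h).elim hnd hq2)
    exact three_sq_of m (2*q) hm0 (by omega)
      (Nat.Coprime.mul_right (Nat.coprime_two_right.mpr hmo) (hq.coprime_iff_not_dvd.mpr hnd).symm)
      (not_sq_aux q 2 hq hq2) hmN 1 s'
      (by push_cast; simpa [add_comm] using hd) hsN (u+v) ((u:ℤ)-v).natAbs
      (by zify; rw [sq_abs, ← huv]; push_cast; ring)
  · obtain ⟨k, rfl⟩ : ∃ k, m = 2*k := ⟨m/2, by omega⟩
    have hko : Odd k := Nat.odd_iff.mpr (by omega)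
    have hcop : Nat.Coprime (2*k-1) (8*k) := by
      have h1 : Nat.Coprime (2*k-1) (2*k) := by
        have := Nat.coprime_self_add_right (m := 2*k-1) (n := 1)
        rw [show 2*k-1+1 = 2*k by omega] at this
        simpa using this
      have h2 : Nat.Coprime (2*k-1) k := Nat.Coprime.coprime_mul_left_right h1
      have h3 : Nat.Coprime (2*k-1) 2 := Nat.Coprime.coprime_mul_right_right h1
      exact Nat.Coprime.mul_right (Nat.Coprime.pow_right 3 h3) h2
    obtain ⟨q, hlt, hq, hmod⟩ := dirichlet_aux (2*k) (2*k-1) (8*k) (by omega) hcop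
    have e8 := mod_dvd _ _ _ 8 hmod ⟨k, rfl⟩
    have em := mod_dvd _ _ _ (2*k) hmod ⟨4, by ring⟩
    have q4 : q % 4 = 1 := by omega
    have hd : ((2*k:ℕ):ℤ) ∣ q + 1 := by
      have h5 : (q:ℤ) ≡ (2*k-1:ℕ) [ZMOD (2*k:ℕ)] := (Int.natCast_modEq_iff).mpr em
      have h6 := h5.symm.dvd
      rw [Nat.cast_sub (by omega)] at h6
      push_cast at h6 ⊢
      obtain ⟨w, hw⟩ := h6
      exact ⟨w+1, by linear_combination hw⟩
    refine case_q (2*k) q hm0 hq hlt q4 hd ?_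
    have hqo : Odd q := Nat.odd_iff.mpr (by omega)
    push_cast
    rw [jacobiSym.mul_left, jacobiSym.at_two hqo,
      jacobiSym.quadratic_reciprocity_one_mod_four' hko q4,
      jac_aux k q hko (dvd_trans ⟨2, by push_cast; ring⟩ hd)]
    rw [ZMod.χ₈_nat_eq_if_mod_eight, if_neg (by omega)]
    have : k % 4 = 1 ∨ k % 4 = 3 := by omega
    rcases this with h9 | h9
    · rw [ZMod.χ₄_nat_one_mod_four h9, if_pos (by omega)]; rfl
    · rw [ZMod.χ₄_nat_three_mod_four h9, if_neg (by omega)]; rfl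

theorem normq {K : Type} [Field K] (a b c e : K) :
    (⟨a, b, c, e⟩ : ℍ[K, -1, -1]) * ⟨a, -b, -c, -e⟩ = ⟨a^2+b^2+c^2+e^2, 0, 0, 0⟩ := by
  rw [QuaternionAlgebra.mk_mul_mk]
  ext <;> simp <;> ring

theorem normq' {K : Type} [Field K] (a b c e r : K) (h : r * (a^2+b^2+c^2+e^2) = 1) :
    (⟨a, b, c, e⟩ : ℍ[K, -1, -1]) * ⟨r*a, -(r*b), -(r*c), -(r*e)⟩ = 1 := by
  rw [QuaternionAlgebra.mk_mul_mk]
  ext <;> simp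
  · linear_combination h
  all_goals ring

theorem normq'' {K : Type} [Field K] (a b c e r : K) (h : r * (a^2+b^2+c^2+e^2) = 1) :
    (⟨r*a, -(r*b), -(r*c), -(r*e)⟩ : ℍ[K, -1, -1]) * ⟨a, b, c, e⟩ = 1 := by
  rw [QuaternionAlgebra.mk_mul_mk]
  ext <;> simp
  · linear_combination h
  all_goals ring

theorem not_unit_aux {K : Type} [Field K] (a b c e : K) (h : a^2+b^2+c^2+e^2 = 0) (ha : a ≠ 0) :
    ¬ IsUnit (⟨a, b, c, e⟩ : ℍ[K, -1, -1]) := by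
  intro hu
  have h1 := normq a b c e
  rw [h] at h1
  have h2 : (⟨a, -b, -c, -e⟩ : ℍ[K, -1, -1]) = 0 := by
    refine hu.mul_left_cancel ?_
    rw [h1, mul_zero]; rfl
  exact ha (congrArg QuaternionAlgebra.re h2)

/-- Let `d` be a squarefree negative integer and `K = ℚ(√d)`
(i.e. a field extension of `ℚ` of degree 2 containing a square root of `d`).
Then the quaternion algebra `ℍ(K) = (−1,−1/K)` is a division ring
if and only if `d ≡ 1 (mod 8)`. -/
theorem quaternion_division_iff_one_mod_eight
    (d : ℤ) (hd : Squarefree d) (hdneg : d < 0)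
    (K : Type) [Field K] [Algebra ℚ K]
    (hrank : Module.finrank ℚ K = 2) (α : K) (hα : α ^ 2 = (d : K)) :
    (∀ x : ℍ[K, -1, -1], x ≠ 0 → IsUnit x) ↔ d % 8 = 1 := by
  have hchar : CharZero K := algebraRat.charZero K
  have hα0 : α ≠ 0 := by
    rintro rfl
    have : (d:K) ≠ 0 := by exact_mod_cast hdneg.ne
    apply this; rw [← hα]; ring
  constructor
  · intro H
    by_contra hd8
    obtain ⟨m, hm⟩ : ∃ m : ℕ, (m:ℤ) = -d := ⟨d.natAbs, by omega⟩
    have h4 : d % 4 ≠ 0 := by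
      intro h4
      have := hd 2 (by omega)
      rw [Int.isUnit_iff] at this
      omega
    obtain ⟨n, x, y, z, hn, e⟩ := three_squares m (by omega)
    have hnK : (n:K) ≠ 0 := by exact_mod_cast hn
    have h0 : α * n ≠ 0 := mul_ne_zero hα0 hnK
    refine not_unit_aux (α*n) (x:K) y z ?_ h0 (H _ ?_)
    · have e' : (-(d:K)) * n^2 = x^2+y^2+z^2 := by
        rw [hm] at e
        exact_mod_cast congrArg (Int.cast : ℤ → K) e
      rw [mul_pow, hα]; linear_combination -e'
    · intro h
      exact h0 (congrArg QuaternionAlgebra.re h)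
  · intro hd8
    have hind : ∀ a b : ℚ, (a:K) + b * α = 0 → a = 0 ∧ b = 0 := by
      intro a b h
      have h1 : (a:K)^2 = b^2 * d := by
        rw [← hα]; linear_combination (a - b*α) * h
      have h2 : a^2 = b^2 * d := by exact_mod_cast h1
      have hdq : (d:ℚ) < 0 := by exact_mod_cast hdneg
      have hb : b = 0 := by
        by_contra hb
        have : 0 < b^2 := by positivity
        nlinarith [sq_nonneg a]
      subst hb
      simpa using h
    have hspan : ∀ x : K, ∃ a b : ℚ, x = a + b * α := by
      have hli : LinearIndependent ℚ ![(1:K), α] := by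
        rw [LinearIndependent.pair_iff]
        intro s t h
        apply hind s t
        simpa [Algebra.smul_def] using h
      have hs := hli.span_eq_top_of_card_eq_finrank (by simp [hrank])
      intro x
      have hx : x ∈ Submodule.span ℚ (Set.range ![(1:K), α]) := by rw [hs]; trivial
      simp only [Matrix.range_cons, Matrix.range_empty, Set.union_empty, Set.singleton_union, Submodule.mem_span_pair] at hx
      obtain ⟨a, b, h⟩ := hx
      exact ⟨a, b, by rw [← h]; simp [Algebra.smul_def]⟩
    rintro ⟨x, y, z, w⟩ hne
    by_cases hN : x^2+y^2+z^2+w^2 = 0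
    · exfalso
      obtain ⟨a1, b1, rfl⟩ := hspan x
      obtain ⟨a2, b2, rfl⟩ := hspan y
      obtain ⟨a3, b3, rfl⟩ := hspan z
      obtain ⟨a4, b4, rfl⟩ := hspan w
      have h := hind (a1^2+a2^2+a3^2+a4^2 + d*(b1^2+b2^2+b3^2+b4^2))
        (2*(a1*b1+a2*b2+a3*b3+a4*b4)) (by
          push_cast
          linear_combination hN - ((b1:K)^2+b2^2+b3^2+b4^2)*hα)
      obtain ⟨h1, h2⟩ := h
      by_cases hB : b1^2+b2^2+b3^2+b4^2 = 0
      · rw [hB] at h1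
        have z1 : a1 = 0 := by nlinarith [sq_nonneg a1, sq_nonneg a2, sq_nonneg a3, sq_nonneg a4]
        have z2 : a2 = 0 := by nlinarith [sq_nonneg a1, sq_nonneg a2, sq_nonneg a3, sq_nonneg a4]
        have z3 : a3 = 0 := by nlinarith [sq_nonneg a1, sq_nonneg a2, sq_nonneg a3, sq_nonneg a4]
        have z4 : a4 = 0 := by nlinarith [sq_nonneg a1, sq_nonneg a2, sq_nonneg a3, sq_nonneg a4]
        have y1 : b1 = 0 := by nlinarith [sq_nonneg b1, sq_nonneg b2, sq_nonneg b3, sq_nonneg b4]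
        have y2 : b2 = 0 := by nlinarith [sq_nonneg b1, sq_nonneg b2, sq_nonneg b3, sq_nonneg b4]
        have y3 : b3 = 0 := by nlinarith [sq_nonneg b1, sq_nonneg b2, sq_nonneg b3, sq_nonneg b4]
        have y4 : b4 = 0 := by nlinarith [sq_nonneg b1, sq_nonneg b2, sq_nonneg b3, sq_nonneg b4]
        apply hne
        subst z1 z2 z3 z4 y1 y2 y3 y4
        ext <;> simp
      · refine seven_rat (-d) (by omega) (b1^2+b2^2+b3^2+b4^2)
          (a1*b2-a2*b1+a3*b4-a4*b3) (a1*b3-a3*b1+a4*b2-a2*b4) (a1*b4-a4*b1+a2*b3-a3*b2) hB ?_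
        push_cast
        linear_combination (b1^2+b2^2+b3^2+b4^2)*h1 - (a1*b1+a2*b2+a3*b3+a4*b4)/2*h2
    · have hr := inv_mul_cancel₀ hN
      exact ⟨⟨_, _, normq' x y z w _ hr, normq'' x y z w _ hr⟩, rfl⟩
end

section
/- Let K be a number field and D a division ring that is a 4-dimensional K-algebra with center K (a quaternion division algebra over K). If there exists a finite subgroup G of the group of units D* such that D is generated by G as a K-algebra, then there exists a finite metabelian subgroup M of D* such that D is generated by M as a K-algebra. -/
open scoped commutatorElement

/-- A nonabelian finite `p`-group contains two noncommuting elements generating a subgroup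
whose commutators are central. -/
lemma exists_pair_of_pGroup {P : Type*} [Group P] [Finite P] {p : ℕ} [Fact p.Prime]
    (hP : IsPGroup p P) (hnc : ¬ ∀ a b : P, a * b = b * a) :
    ∃ x y : P, x * y ≠ y * x ∧
      ∀ a ∈ Subgroup.closure {x, y}, ∀ b ∈ Subgroup.closure {x, y},
        ⁅a, b⁆ ∈ Subgroup.center P := by
  let Q := P ⧸ Subgroup.center P
  have hQ : IsPGroup p Q := hP.to_quotient _
  have hnt : Nontrivial Q := by
    by_contra hq
    rw [not_nontrivial_iff_subsingleton] at hq
    have htop : Subgroup.center P = ⊤ := QuotientGroup.subgroup_eq_top_of_subsingleton _ hq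
    apply hnc
    intro a b
    have : b ∈ Subgroup.center P := by rw [htop]; trivial
    exact Subgroup.mem_center_iff.mp this a
  have := hQ.center_nontrivial
  obtain ⟨⟨q, hq⟩, hq1⟩ := exists_ne (1 : Subgroup.center Q)
  obtain ⟨x, rfl⟩ := QuotientGroup.mk'_surjective (Subgroup.center P) q
  have hx : x ∉ Subgroup.center P := by
    intro hx
    apply hq1
    apply Subtype.ext
    exact (QuotientGroup.eq_one_iff x).mpr hx
  rw [Subgroup.mem_center_iff] at hx
  push Not at hx
  obtain ⟨y, hy⟩ := hx
  refine ⟨x, y, hy.symm, ?_⟩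
  let π := QuotientGroup.mk' (Subgroup.center P)
  have hcomm : π x * π y = π y * π x := (Subgroup.mem_center_iff.mp hq (π y)).symm
  have hcl : IsMulCommutative (Subgroup.closure ({π x, π y} : Set Q)) := by
    apply Subgroup.isMulCommutative_closure
    rintro a (rfl | rfl) b (rfl | rfl)
    · rfl
    · exact hcomm
    · exact hcomm.symm
    · rfl
  have hmem : ∀ a ∈ Subgroup.closure {x, y}, π a ∈ Subgroup.closure ({π x, π y} : Set Q) := by
    intro a ha
    have h1 := Subgroup.mem_map_of_mem π ha
    rw [MonoidHom.map_closure, Set.image_pair] at h1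
    exact h1
  intro a ha b hb
  have h2 : π a * π b = π b * π a := setLike_mul_comm (hmem a ha) (hmem b hb)
  rw [← QuotientGroup.eq_one_iff]
  change π ⁅a, b⁆ = 1
  rw [map_commutatorElement, commutatorElement_eq_one_iff_mul_comm]
  exact h2

/-- A finite commutative subgroup of a division ring is cyclic. -/
lemma isCyclic_of_comm_of_injective {D P : Type*} [DivisionRing D] [Group P] [Finite P]
    (f : P →* Dˣ) (hf : Function.Injective f) (hc : ∀ a b : P, a * b = b * a) :
    IsCyclic P := by
  let s : Set D := Set.range fun a : P => (f a : D)
  have hs : ∀ x ∈ s, ∀ y ∈ s, x * y = y * x := by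
    rintro _ ⟨a, rfl⟩ _ ⟨b, rfl⟩
    simp only [← Units.val_mul, ← map_mul, hc a b]
  have : IsMulCommutative (Subring.closure s) := Subring.isMulCommutative_closure hs
  let _ : CommRing (Subring.closure s) :=
    { (inferInstance : Ring (Subring.closure s)) with
      mul_comm := fun a b => Subtype.ext (setLike_mul_comm a.2 b.2) }
  have : IsDomain (Subring.closure s) := inferInstance
  let g : P →* Subring.closure s :=
    { toFun := fun a => ⟨(f a : D), Subring.subset_closure ⟨a, rfl⟩⟩
      map_one' := by ext; simp
      map_mul' := fun a b => by ext; simp }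
  apply isCyclic_of_injective_ringHom g
  intro a b hab
  apply hf
  apply Units.ext
  exact congrArg Subtype.val hab

/-- A subalgebra of a 4-dimensional division algebra with two noncommuting elements is
everything. -/
lemma subalgebra_eq_top_of_noncomm {K D : Type*} [Field K] [DivisionRing D] [Algebra K D]
    (hdim : Module.finrank K D = 4) (S : Subalgebra K D) {x y : D} (hx : x ∈ S) (hy : y ∈ S)
    (hxy : x * y ≠ y * x) : S = ⊤ := by
  have : FiniteDimensional K D := Module.finite_of_finrank_pos (by omega)
  let _ : DivisionRing S := divisionRingOfFiniteDimensional K S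
  have hmul : Module.finrank K S * Module.finrank S D = 4 := by
    rw [← hdim]; exact Module.finrank_mul_finrank K S D
  have hli : LinearIndependent K ![(⟨y, hy⟩ : S), ⟨x, hx⟩, 1] := by
    rw [Fintype.linearIndependent_iff]
    intro g hg
    have hg' : g 0 • y + g 1 • x + g 2 • (1 : D) = 0 := by
      have := congrArg Subtype.val hg
      simpa [Fin.sum_univ_three] using this
    have e1 : g 0 • (x * y - y * x) = 0 := by
      have a1 := congrArg (fun z => x * z - z * x) hg'
      simp only [mul_add, add_mul, mul_smul_comm, smul_mul_assoc, mul_one, one_mul, mul_zero,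
        zero_mul, sub_zero] at a1
      rw [smul_sub, ← a1]; abel
    have e2 : g 1 • (x * y - y * x) = 0 := by
      have a1 := congrArg (fun z => z * y - y * z) hg'
      simp only [mul_add, add_mul, mul_smul_comm, smul_mul_assoc, mul_one, one_mul, mul_zero,
        zero_mul, sub_zero] at a1
      rw [smul_sub, ← a1]; abel
    have hne : x * y - y * x ≠ 0 := sub_ne_zero.mpr hxy
    have h0 : g 0 = 0 := (smul_eq_zero.mp e1).resolve_right hne
    have h1 : g 1 = 0 := (smul_eq_zero.mp e2).resolve_right hne
    have h2 : g 2 = 0 := by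
      rw [h0, h1, zero_smul, zero_smul, zero_add, zero_add] at hg'
      exact (smul_eq_zero.mp hg').resolve_right one_ne_zero
    intro i
    fin_cases i
    · exact h0
    · exact h1
    · exact h2
  have h3 : 3 ≤ Module.finrank K S := by
    simpa using hli.fintype_card_le_finrank
  have hdvd : Module.finrank K S ∣ 4 := ⟨_, hmul.symm⟩
  have hle := Nat.le_of_dvd (by norm_num) hdvd
  have h4 : Module.finrank K S = 4 := by
    interval_cases h : Module.finrank K S
    · omega
    · rfl
  apply Algebra.toSubmodule_eq_top.mp
  apply Submodule.eq_top_of_finrank_eq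
  rw [hdim]; exact h4

/-- Let `K` be a number field and `D` a division ring that is a
4-dimensional `K`-algebra with center `K` (a quaternion division algebra over `K`).
If there is a finite subgroup `G` of `Dˣ` generating `D` as a `K`-algebra, then there
is a finite *metabelian* subgroup `M` of `Dˣ` (i.e. the commutator subgroup of `M` is
abelian) generating `D` as a `K`-algebra. -/
theorem quaternion_schur_algebra_generated_by_metabelian
    (K : Type) [Field K] [NumberField K]
    (D : Type) [DivisionRing D] [Algebra K D]
    (hdim : Module.finrank K D = 4)
    (hcenter : Subalgebra.center K D = ⊥)
    (h : ∃ G : Subgroup Dˣ, Finite G ∧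
      Algebra.adjoin K (Units.val '' (G : Set Dˣ)) = ⊤) :
    ∃ M : Subgroup Dˣ, Finite M ∧
      (∀ x y : commutator ↥M, x * y = y * x) ∧
      Algebra.adjoin K (Units.val '' (M : Set Dˣ)) = ⊤ := by
  obtain ⟨G, hfin, hG⟩ := h
  by_cases hab : ∀ (p : ℕ) (_ : p.Prime) (P : Sylow p G), ∀ a b : P, a * b = b * a
  · -- all Sylow subgroups are commutative, hence cyclic, so `G` is a Z-group
    have hZ : IsZGroup G := by
      refine ⟨fun p hp P => ?_⟩
      exact isCyclic_of_comm_of_injective (G.subtype.comp (P : Subgroup G).subtype)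
        (G.subtype_injective.comp (P : Subgroup G).subtype_injective) (hab p hp P)
    refine ⟨G, hfin, ?_, hG⟩
    have hc : IsCyclic (commutator G) := IsZGroup.isCyclic_commutator G
    intro x y
    have := hc.isMulCommutative
    exact mul_comm' x y
  · push Not at hab
    obtain ⟨p, hp, P, a, b, hne⟩ := hab
    have : Fact p.Prime := ⟨hp⟩
    obtain ⟨x, y, hxy, hcen⟩ := exists_pair_of_pGroup (P := P) P.isPGroup'
      (fun hh => hne (hh a b))
    let f : P →* Dˣ := G.subtype.comp (P : Subgroup G).subtype
    have hf : Function.Injective f :=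
      G.subtype_injective.comp (P : Subgroup G).subtype_injective
    let M := (Subgroup.closure {x, y}).map f
    have hxM : f x ∈ M := Subgroup.mem_map_of_mem f (Subgroup.subset_closure (by simp))
    have hyM : f y ∈ M := Subgroup.mem_map_of_mem f (Subgroup.subset_closure (by simp))
    refine ⟨M, ?_, ?_, ?_⟩
    · exact (Set.toFinite ((Subgroup.closure {x, y} : Subgroup P) : Set P)).image f
    · have hle : commutator M ≤ Subgroup.center M := by
        rw [commutator_def, Subgroup.commutator_le]
        rintro ⟨_, a, ha, rfl⟩ - ⟨_, b, hb, rfl⟩ -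
        rw [Subgroup.mem_center_iff]
        rintro ⟨_, c, hc, rfl⟩
        apply Subtype.ext
        have h1 := congrArg f (Subgroup.mem_center_iff.mp (hcen a ha b hb) c)
        simpa [commutatorElement_def] using h1
      rintro x ⟨y, hy⟩
      apply Subtype.ext
      exact Subgroup.mem_center_iff.mp (hle hy) x
    · refine subalgebra_eq_top_of_noncomm hdim _ (x := (f x : D)) (y := (f y : D))
        (Algebra.subset_adjoin ⟨_, hxM, rfl⟩) (Algebra.subset_adjoin ⟨_, hyM, rfl⟩) ?_
      intro he
      apply hxy
      apply hf
      apply Units.ext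
      simpa using he
end

section
/- Let A₁, …, Aₙ be finite-dimensional simple ℚ-algebras and let S be an order in the product A = A₁ × ⋯ × Aₙ. Then the group of units S* is finite if and only if for each i, the algebra Aᵢ is isomorphic to ℚ, to an imaginary quadratic field, or to a totally definite quaternion algebra over ℚ (i.e., to (a,b/ℚ) with a < 0 and b < 0). -/
open Quaternion

/-- An order in a finite-dimensional `ℚ`-algebra `A`: a subring that is finitely
generated as a `ℤ`-module and whose `ℚ`-span is all of `A`. -/
def IsOrderIn {A : Type} [Ring A] [Algebra ℚ A] (S : Subring A) : Prop :=
  S.toAddSubgroup.FG ∧ Submodule.span ℚ (S : Set A) = ⊤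

set_option linter.style.haveILetI false
lemma exists_nsmul_mem {V : Type*} [AddCommGroup V] [Module ℚ V] (M : AddSubgroup V)
    (hM : Submodule.span ℚ (M : Set V) = ⊤) (y : V) : ∃ N : ℕ, N ≠ 0 ∧ N • y ∈ M := by
  have hy : y ∈ Submodule.span ℚ (M : Set V) := by rw [hM]; trivial
  induction hy using Submodule.span_induction with
  | mem x hx => exact ⟨1, one_ne_zero, by simpa using hx⟩
  | zero => exact ⟨1, one_ne_zero, by simp⟩
  | add x y _ _ hx hy =>
    obtain ⟨a, ha, hxa⟩ := hx
    obtain ⟨b, hb, hyb⟩ := hy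
    refine ⟨a * b, mul_ne_zero ha hb, ?_⟩
    rw [smul_add]
    refine M.add_mem ?_ ?_
    · rw [mul_comm, mul_smul]; exact M.nsmul_mem hxa b
    · rw [mul_smul]; exact M.nsmul_mem hyb a
  | smul r x _ hx =>
    obtain ⟨a, ha, hxa⟩ := hx
    refine ⟨r.den * a, mul_ne_zero r.den_ne_zero ha, ?_⟩
    have : (r.den * a) • (r • x) = r.num • (a • x) := by
      rw [← Nat.cast_smul_eq_nsmul ℚ, ← Int.cast_smul_eq_zsmul ℚ, ← Nat.cast_smul_eq_nsmul ℚ,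
        smul_smul, smul_smul]
      congr 1
      push_cast
      have := Rat.den_mul_eq_num r
      linear_combination (a : ℚ) * this
    rw [this]
    exact M.zsmul_mem hxa _

lemma exists_nsmul_mem_of_fg {V : Type*} [AddCommGroup V] [Module ℚ V] (M : AddSubgroup V)
    (hM : Submodule.span ℚ (M : Set V) = ⊤) (T : AddSubgroup V) (hT : T.FG) :
    ∃ N : ℕ, N ≠ 0 ∧ ∀ y ∈ T, N • y ∈ M := by
  obtain ⟨s, rfl⟩ := hT
  have key : ∃ N : ℕ, N ≠ 0 ∧ ∀ y ∈ s, N • y ∈ M := by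
    classical
    induction s using Finset.induction_on with
    | empty => exact ⟨1, one_ne_zero, by simp⟩
    | insert x s _ ih =>
      obtain ⟨a, ha, hxa⟩ := ih
      obtain ⟨b, hb, hyb⟩ := exists_nsmul_mem M hM x
      refine ⟨a * b, mul_ne_zero ha hb, ?_⟩
      intro y hy
      rcases Finset.mem_insert.1 hy with rfl | hy
      · rw [mul_smul]; exact M.nsmul_mem hyb a
      · rw [mul_comm, mul_smul]; exact M.nsmul_mem (hxa y hy) b
  obtain ⟨N, hN, h⟩ := key
  refine ⟨N, hN, fun y hy => ?_⟩
  induction hy using AddSubgroup.closure_induction with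
  | mem x hx => exact h x hx
  | zero => simp
  | add x y _ _ hx hy => rw [smul_add]; exact M.add_mem hx hy
  | neg x _ hx => rw [smul_neg]; exact M.neg_mem hx

lemma finite_units_of_embed {A : Type*} [Ring A] [IsSimpleRing A] [Algebra ℚ A]
    [FiniteDimensional ℚ A]
    {D : Type*} [NormedDivisionRing D] [NormedAlgebra ℝ D]
    [FiniteDimensional ℝ D] {ι : Type*} [Fintype ι] (f : A →+* D) (v : ι → A)
    (hli : LinearIndependent ℝ (fun k => f (v k))) (h1 : Fintype.card ι = Module.finrank ℚ A)
    (h2 : Fintype.card ι = Module.finrank ℝ D) (T : Subring A) (hT : T.toAddSubgroup.FG) :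
    Finite (↥T)ˣ := by
  have hf : Function.Injective f := f.injective
  letI : Algebra ℚ D := Algebra.compHom D (algebraMap ℚ ℝ)
  have hv : LinearIndependent ℚ v := by
    have h := hli.restrict_scalars' ℚ
    exact LinearIndependent.of_comp (f.toRatAlgHom.toLinearMap) h
  haveI : Nonempty ι := by
    rw [← Fintype.card_pos_iff, h1]
    exact Module.finrank_pos
  have hspan : Submodule.span ℚ (Set.range v) = ⊤ :=
    hv.span_eq_top_of_card_eq_finrank' h1
  let B := basisOfLinearIndependentOfCardEqFinrank hli h2
  let M : AddSubgroup A := (Submodule.span ℤ (Set.range v)).toAddSubgroup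
  have hM : Submodule.span ℚ (M : Set A) = ⊤ := by
    rw [eq_top_iff, ← hspan]
    exact Submodule.span_mono Submodule.subset_span
  obtain ⟨N, hN, hNT⟩ := exists_nsmul_mem_of_fg M hM _ hT
  have hfM : ∀ x ∈ M, f x ∈ Submodule.span ℤ (Set.range B) := by
    intro x hx
    change x ∈ Submodule.span ℤ (Set.range v) at hx
    induction hx using Submodule.span_induction with
    | mem x hx =>
      obtain ⟨k, rfl⟩ := hx
      exact Submodule.subset_span ⟨k, by simp [B]⟩
    | zero => simp
    | add x y _ _ hx hy => rw [map_add]; exact Submodule.add_mem _ hx hy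
    | smul r x _ hx => rw [map_zsmul]; exact Submodule.smul_mem _ _ hx
  haveI : ProperSpace D := FiniteDimensional.proper ℝ D
  have hfin : Set.Finite {x : T | ‖f x‖ ≤ 1} := by
    have h := ZSpan.setFinite_inter B (s := Metric.closedBall 0 (N : ℝ)) Metric.isBounded_closedBall
    refine Set.Finite.of_finite_image (f := fun x : T => f (N • (x : A))) (h.subset ?_) ?_
    · rintro _ ⟨x, hx, rfl⟩
      refine ⟨?_, hfM _ (hNT _ x.2)⟩
      simp only [mem_closedBall_zero_iff]
      rw [map_nsmul, nsmul_eq_mul, norm_mul]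
      have : ‖(N : D)‖ = N := by
        rw [← map_natCast (algebraMap ℝ D), norm_algebraMap']; simp
      rw [this]
      have := Set.mem_ofPred_eq ▸ hx
      have h0 : (0:ℝ) ≤ N := by positivity
      exact mul_le_of_le_one_right h0 this
    · intro x _ y _ hxy
      have h := hf hxy
      simp only [← Nat.cast_smul_eq_nsmul ℚ] at h
      exact Subtype.ext (smul_right_injective A (Nat.cast_ne_zero.2 hN : (N:ℚ) ≠ 0) h)
  have hnolt : ∀ u : (↥T)ˣ, ¬ ‖f ((u : T) : A)‖ < 1 := by
    intro u hu
    have hne : 0 < ‖f ((u : T) : A)‖ := by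
      have : f ((u : T) : A) * f ((↑(u⁻¹) : T) : A) = 1 := by
        rw [← map_mul, ← Subring.coe_mul, Units.mul_inv]; simp
      exact norm_pos_iff.2 (left_ne_zero_of_mul_eq_one this)
    haveI := hfin.to_subtype
    let g : ℕ → {x : T | ‖f x‖ ≤ 1} := fun m => ⟨(u : T) ^ m, by
      simp only [Set.mem_ofPred_eq, Subring.coe_pow, map_pow, norm_pow]
      exact pow_le_one₀ hne.le hu.le⟩
    obtain ⟨m, m', hmm, h⟩ := Finite.exists_ne_map_eq_of_infinite g
    have h' := congrArg (fun x : {x : T | ‖f x‖ ≤ 1} => ‖f ((x : T) : A)‖) h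
    simp only [g, Subring.coe_pow, map_pow, norm_pow] at h'
    exact hmm (pow_right_injective₀ hne hu.ne h')
  have hle : ∀ u : (↥T)ˣ, ‖f ((u : T) : A)‖ ≤ 1 := by
    intro u
    by_contra! h
    apply hnolt u⁻¹
    have : f ((u : T) : A) * f ((↑(u⁻¹) : T) : A) = 1 := by
      rw [← map_mul, ← Subring.coe_mul, Units.mul_inv]; simp
    have h2 := congrArg norm this
    rw [norm_mul, norm_one] at h2
    by_contra! h3
    nlinarith
  haveI := hfin.to_subtype
  exact Finite.of_injective (fun u : (↥T)ˣ => (⟨(u : T), hle u⟩ : {x : T | ‖f x‖ ≤ 1}))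
    (fun a b hab => Units.ext (congrArg Subtype.val hab))

lemma finrank_eq_of_ringEquiv {A B : Type*} [Ring A] [Ring B] [Algebra ℚ A] [Algebra ℚ B]
    (e : A ≃+* B) : Module.finrank ℚ A = Module.finrank ℚ B :=
  (AlgEquiv.ofRingEquiv (f := e) (fun r => RingHom.map_rat_algebraMap e.toRingHom r)).toLinearEquiv.finrank_eq

lemma finite_units_rat {A : Type*} [Ring A] [IsSimpleRing A] [Algebra ℚ A]
    [FiniteDimensional ℚ A] (e : A ≃+* ℚ) (T : Subring A) (hT : T.toAddSubgroup.FG) :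
    Finite (↥T)ˣ := by
  refine finite_units_of_embed (D := ℝ) (ι := Unit) ((algebraMap ℚ ℝ).comp e.toRingHom)
    (fun _ => 1) ?_ ?_ ?_ T hT
  · simp
  · rw [finrank_eq_of_ringEquiv e]; simp
  · simp

lemma finite_units_quadratic {A : Type*} [Ring A] [IsSimpleRing A] [Algebra ℚ A]
    [FiniteDimensional ℚ A] {K : Type*} [Field K] [Algebra ℚ K] (hK : Module.finrank ℚ K = 2)
    (hR : IsEmpty (K →+* ℝ)) (e : A ≃+* K) (T : Subring A) (hT : T.toAddSubgroup.FG) :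
    Finite (↥T)ˣ := by
  haveI : FiniteDimensional ℚ K := FiniteDimensional.of_finrank_pos (by omega)
  let g : K →+* ℂ := (IsAlgClosed.lift : K →ₐ[ℚ] ℂ).toRingHom
  have hα : ∃ α : K, (g α).im ≠ 0 := by
    by_contra! h
    refine hR.false ⟨⟨⟨fun x => (g x).re, by simp⟩, fun x y => ?_⟩, by simp, fun x y => ?_⟩
    · simp [h]
    · simp
  obtain ⟨α, hα⟩ := hα
  refine finite_units_of_embed (D := ℂ) (ι := Fin 2) (g.comp e.toRingHom)
    ![1, e.symm α] ?_ ?_ ?_ T hT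
  · rw [Fintype.linearIndependent_iff]
    intro c hc
    simp only [Fin.sum_univ_two] at hc
    have him := congrArg Complex.im hc
    have hre := congrArg Complex.re hc
    simp at him hre
    have h1 : c 1 = 0 := by tauto
    simp [h1] at hre
    intro k; fin_cases k <;> assumption
  · rw [finrank_eq_of_ringEquiv e, hK]; simp
  · simp

lemma finite_units_quaternion {A : Type*} [Ring A] [IsSimpleRing A] [Algebra ℚ A]
    [FiniteDimensional ℚ A] {a b : ℚ} (ha : a < 0) (hb : b < 0)
    (e : A ≃+* ℍ[ℚ, a, b]) (T : Subring A) (hT : T.toAddSubgroup.FG) :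
    Finite (↥T)ˣ := by
  have ha' : (0:ℝ) < -a := by exact_mod_cast neg_pos.2 ha
  have hb' : (0:ℝ) < -b := by exact_mod_cast neg_pos.2 hb
  set s := Real.sqrt (-a) with hs
  set t := Real.sqrt (-b) with ht
  have hs0 : s ≠ 0 := (Real.sqrt_pos.2 ha').ne'
  have ht0 : t ≠ 0 := (Real.sqrt_pos.2 hb').ne'
  have hs2 : s * s = -a := Real.mul_self_sqrt ha'.le
  have ht2 : t * t = -b := Real.mul_self_sqrt hb'.le
  have hsm : ∀ (r : ℚ) (x : ℍ[ℝ]), r • x = (r : ℝ) • x := fun r x => by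
    rw [← Rat.cast_smul_eq_qsmul ℝ]
  obtain ⟨I, I1, I2, I3, I4⟩ : ∃ I : ℍ[ℝ], I.re = 0 ∧ I.imI = s ∧ I.imJ = 0 ∧ I.imK = 0 :=
    ⟨⟨0, s, 0, 0⟩, rfl, rfl, rfl, rfl⟩
  obtain ⟨J, J1, J2, J3, J4⟩ : ∃ I : ℍ[ℝ], I.re = 0 ∧ I.imI = 0 ∧ I.imJ = t ∧ I.imK = 0 :=
    ⟨⟨0, 0, t, 0⟩, rfl, rfl, rfl, rfl⟩
  let Q : QuaternionAlgebra.Basis ℍ[ℝ] a 0 b :=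
    { i := I
      j := J
      k := I * J
      i_mul_i := by
        rw [hsm, hsm]; ext <;> simp [I1, I2, I3, I4, hs2]
      j_mul_j := by rw [hsm]; ext <;> simp [J1, J2, J3, J4, ht2]
      i_mul_j := rfl
      j_mul_i := by rw [hsm]; ext <;> simp [I1, I2, I3, I4, J1, J2, J3, J4, mul_comm] }
  refine finite_units_of_embed (D := ℍ[ℝ]) (ι := Fin 4) (Q.liftHom.toRingHom.comp e.toRingHom)
    (fun k => e.symm (![1, ⟨0,1,0,0⟩, ⟨0,0,1,0⟩, ⟨0,0,0,1⟩] k)) ?_ ?_ ?_ T hT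
  · rw [Fintype.linearIndependent_iff]
    intro c hc
    have e1 : Q.liftHom.toRingHom (1 : ℍ[ℚ, a, b]) = 1 := map_one _
    have e2 : Q.liftHom.toRingHom (⟨0,1,0,0⟩ : ℍ[ℚ, a, b]) = I := by
      simp [QuaternionAlgebra.Basis.liftHom, QuaternionAlgebra.Basis.lift, Q]
    have e3 : Q.liftHom.toRingHom (⟨0,0,1,0⟩ : ℍ[ℚ, a, b]) = J := by
      simp [QuaternionAlgebra.Basis.liftHom, QuaternionAlgebra.Basis.lift, Q]
    have e4 : Q.liftHom.toRingHom (⟨0,0,0,1⟩ : ℍ[ℚ, a, b]) = I * J := by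
      simp [QuaternionAlgebra.Basis.liftHom, QuaternionAlgebra.Basis.lift, Q]
    simp only [Fin.sum_univ_four, RingHom.comp_apply, RingEquiv.toRingHom_eq_coe,
      RingEquiv.coe_toRingHom, RingEquiv.apply_symm_apply, Matrix.cons_val_zero,
      Matrix.cons_val_one, Matrix.cons_val, e1, e2, e3, e4] at hc
    have h1 := congrArg QuaternionAlgebra.re hc
    have h2 := congrArg QuaternionAlgebra.imI hc
    have h3 := congrArg QuaternionAlgebra.imJ hc
    have h4 := congrArg QuaternionAlgebra.imK hc
    simp [hs0, ht0, I1, I2, I3, I4, J1, J2, J3, J4] at h1 h2 h3 h4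
    intro k; fin_cases k <;> assumption
  · rw [finrank_eq_of_ringEquiv e, QuaternionAlgebra.finrank_eq_four]; simp
  · rw [Quaternion.finrank_eq_four]; simp

lemma finite_units_pi {n : ℕ} {A : Fin n → Type} [∀ i, Ring (A i)]
    (S : Subring (∀ i, A i)) 
    (h : ∀ i, Finite (↥(S.map (Pi.evalRingHom A i)))ˣ) : Finite (↥S)ˣ := by
  let φ : ∀ i, S →+* (S.map (Pi.evalRingHom A i)) := fun i =>
    ((Pi.evalRingHom A i).comp S.subtype).codRestrict _ (fun x => ⟨x, x.2, rfl⟩)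
  refine Finite.of_injective (fun u : (↥S)ˣ => fun i => Units.map (φ i).toMonoidHom u) ?_
  intro u w huw
  apply Units.ext
  apply Subtype.ext
  funext i
  have := congrArg (fun x => ((Units.val x : (S.map (Pi.evalRingHom A i))) : A i)) (congrFun huw i)
  exact this

lemma exists_collision {R : Type*} [Ring R] (S : Subring R) [Finite (↥S)ˣ] (g g' : ℕ → R)
    (hg : ∀ m, g m ∈ S) (hg' : ∀ m, g' m ∈ S) (h1 : ∀ m, g m * g' m = 1)
    (h2 : ∀ m, g' m * g m = 1) : ∃ m m', m < m' ∧ g m = g m' := by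
  let F : ℕ → (↥S)ˣ := fun m => ⟨⟨g m, hg m⟩, ⟨g' m, hg' m⟩, Subtype.ext (h1 m), Subtype.ext (h2 m)⟩
  obtain ⟨m, m', hmm, h⟩ := Finite.exists_ne_map_eq_of_infinite F
  have h' : g m = g m' := congrArg (fun u : (↥S)ˣ => ((u : S) : R)) h
  rcases lt_or_gt_of_ne hmm with hlt | hlt
  · exact ⟨m, m', hlt, h'⟩
  · exact ⟨m', m, hlt, h'.symm⟩

lemma eq_zero_of_sq_zero {R : Type} [Ring R] [Algebra ℚ R] (S : Subring R) [Finite (↥S)ˣ]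
    (hS : IsOrderIn S) (x : R) (hx : x * x = 0) : x = 0 := by
  obtain ⟨N, hN, hxN⟩ := exists_nsmul_mem S.toAddSubgroup hS.2 x
  have hsq : ∀ a b : ℕ, (a • x) * (b • x) = 0 := by
    intro a b; rw [smul_mul_smul_comm, hx, smul_zero]
  have hmem : ∀ m : ℕ, (m * N) • x ∈ S := by
    intro m; rw [mul_smul]; exact S.nsmul_mem hxN m
  obtain ⟨m, m', hlt, h⟩ := exists_collision S (fun m => 1 + (m * N) • x)
    (fun m => 1 - (m * N) • x) (fun m => S.add_mem S.one_mem (hmem m))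
    (fun m => S.sub_mem S.one_mem (hmem m))
    (fun m => by
      have := hsq (m * N) (m * N)
      rw [add_mul, mul_sub, mul_sub, this]; simp)
    (fun m => by
      have := hsq (m * N) (m * N)
      rw [sub_mul, mul_add, mul_add, this]; simp)
  have h3 : (m * N) • x = (m' * N) • x := add_left_cancel h
  by_contra hx0
  rw [← Nat.cast_smul_eq_nsmul ℚ, ← Nat.cast_smul_eq_nsmul ℚ] at h3
  have h4 := smul_left_injective ℚ hx0 h3
  have h5 : m * N = m' * N := by exact_mod_cast h4
  exact hlt.ne (Nat.eq_of_mul_eq_mul_right (Nat.pos_of_ne_zero hN) h5)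

open NumberField in
lemma rank_eq_zero_of_finite {n : ℕ} {A : Fin n → Type} [∀ i, Ring (A i)] [∀ i, Algebra ℚ (A i)]
    (S : Subring (∀ i, A i)) [Finite (↥S)ˣ] (hS : IsOrderIn S) (i : Fin n) [Nontrivial (A i)]
    (K : Type*) [Field K] [NumberField K] (f : K →+* A i) : NumberField.Units.rank K = 0 := by
  have hf : Function.Injective f := f.injective
  let s : K →+ (∀ i, A i) := (AddMonoidHom.single A i).comp f.toAddMonoidHom
  let T : AddSubgroup (∀ i, A i) := (s.comp (algebraMap (𝓞 K) K).toAddMonoidHom).range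
  have hT : T.FG := by
    have h : AddGroup.FG (𝓞 K) := by
      rw [← Module.Finite.iff_addGroup_fg]; infer_instance
    exact (AddGroup.fg_iff_addSubgroup_fg _).1 (AddGroup.fg_range _)
  obtain ⟨N, hN, hNT⟩ := exists_nsmul_mem_of_fg S.toAddSubgroup hS.2 T hT
  have hsmul : ∀ (a b : K), (1 + s (a - 1)) * (1 + s (b - 1)) = 1 + s (a * b - 1) := by
    intro a b
    funext k
    by_cases hk : k = i
    · subst hk; simp [s]
    · simp [s, hk]
  have hmemS : ∀ t : 𝓞 K, (1 + s (((1 + N * t : 𝓞 K) : K) - 1)) ∈ S := by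
    intro t
    refine S.add_mem S.one_mem ?_
    have := hNT (s (t : K)) ⟨t, rfl⟩
    rw [← map_nsmul] at this
    convert this using 2
    simp
  have hfinord : ∀ u : (𝓞 K)ˣ, IsOfFinOrder u := by
    intro u
    let J : Ideal (𝓞 K) := Ideal.span {(N : 𝓞 K)}
    have hJ : J ≠ ⊥ := by
      simp [J, hN]
    haveI : Finite (𝓞 K ⧸ J) := Ideal.finiteQuotientOfFreeOfNeBot J hJ
    obtain ⟨k, hk, huk⟩ := (isOfFinOrder_iff_pow_eq_one (x := Units.map (Ideal.Quotient.mk J).toMonoidHom u)).1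
      (isOfFinOrder_of_finite _)
    have hcong : ∀ w : (𝓞 K)ˣ, Units.map (Ideal.Quotient.mk J).toMonoidHom w = 1 →
        ∃ t : 𝓞 K, (w : 𝓞 K) = 1 + N * t := by
      intro w hw
      have h := congrArg Units.val hw
      simp only [Units.coe_map, Units.val_one] at h
      have h' : Ideal.Quotient.mk J (w : 𝓞 K) = Ideal.Quotient.mk J 1 := by
        rw [map_one]; exact h
      rw [Ideal.Quotient.eq, Ideal.mem_span_singleton] at h'
      obtain ⟨t, ht⟩ := h'
      exact ⟨t, by rw [← ht]; ring⟩
    have hw : ∀ w : (𝓞 K)ˣ, Units.map (Ideal.Quotient.mk J).toMonoidHom w = 1 →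
        (1 + s (((w : 𝓞 K) : K) - 1)) ∈ S := by
      intro w hw
      obtain ⟨t, ht⟩ := hcong w hw
      rw [ht]; exact hmemS t
    have hpow : ∀ m : ℕ, Units.map (Ideal.Quotient.mk J).toMonoidHom ((u ^ k) ^ m) = 1 := by
      intro m; rw [map_pow, map_pow, huk, one_pow]
    have hinv : ∀ w : (𝓞 K)ˣ, ((w : 𝓞 K) : K) * (((w⁻¹ : (𝓞 K)ˣ) : 𝓞 K) : K) = 1 := by
      intro w
      rw [← map_mul, Units.mul_inv, map_one]
    obtain ⟨m, m', hlt, h⟩ := exists_collision S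
      (fun m => 1 + s ((((u ^ k) ^ m : (𝓞 K)ˣ) : 𝓞 K) - 1))
      (fun m => 1 + s (((((u ^ k) ^ m)⁻¹ : (𝓞 K)ˣ) : 𝓞 K) - 1))
      (fun m => hw _ (hpow m)) (fun m => hw _ (by rw [map_inv, hpow, inv_one]))
      (fun m => by rw [hsmul, hinv]; simp)
      (fun m => by rw [hsmul, mul_comm, hinv]; simp)
    have h3 := congrFun (add_left_cancel h) i
    simp only [s, AddMonoidHom.comp_apply, AddMonoidHom.single_apply, Pi.single_eq_same] at h3
    have h4 := sub_left_injective (hf h3)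
    have h5 : (u ^ k) ^ m = (u ^ k) ^ m' :=
      Units.ext (RingOfIntegers.coe_injective h4)
    rw [isOfFinOrder_iff_pow_eq_one]
    refine ⟨k * (m' - m), Nat.mul_pos hk (by omega), ?_⟩
    rw [pow_mul]
    have h6 : (u ^ k) ^ m * (u ^ k) ^ (m' - m) = (u ^ k) ^ m * 1 := by
      rw [← pow_add, mul_one, h5]; congr 1; omega
    exact mul_left_cancel h6
  by_contra hr
  have j : Fin (NumberField.Units.rank K) := ⟨0, Nat.pos_of_ne_zero hr⟩
  have htor : NumberField.Units.fundSystem K j ∈ NumberField.Units.torsion K :=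
    (CommGroup.mem_torsion _).2 (hfinord _)
  obtain ⟨_, _, huniq⟩ := NumberField.Units.exist_unique_eq_mul_prod K
    (NumberField.Units.fundSystem K j)
  have e1 := huniq (⟨_, htor⟩, 0) (by simp)
  have e2 := huniq (1, Pi.single j 1) (by
    simp only [OneMemClass.coe_one, one_mul]
    rw [Finset.prod_eq_single j]
    · simp
    · intro b _ hb; simp [hb]
    · simp)
  have e3 := congrFun (congrArg Prod.snd (e1.trans e2.symm)) j
  simp at e3

open NumberField in
lemma finrank_of_rank_zero (K : Type*) [Field K] [NumberField K]
    (h : NumberField.Units.rank K = 0) :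
    Module.finrank ℚ K = 1 ∨ (Module.finrank ℚ K = 2 ∧ IsEmpty (K →+* ℝ)) := by
  have h1 := InfinitePlace.card_add_two_mul_card_eq_rank K
  have h2 := InfinitePlace.card_eq_nrRealPlaces_add_nrComplexPlaces K
  have h3 : 0 < Fintype.card (InfinitePlace K) := Fintype.card_pos
  unfold NumberField.Units.rank at h
  by_cases hr : InfinitePlace.nrRealPlaces K = 0
  · right
    refine ⟨by omega, ⟨fun g => ?_⟩⟩
    have := nrRealPlaces_eq_zero_iff.1 hr
    refine IsTotallyComplex.complexEmbedding_not_isReal (Complex.ofRealHom.comp g) ?_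
    rw [ComplexEmbedding.isReal_iff]
    ext x
    simp
  · left; omega

lemma finrank_of_hom {n : ℕ} {A : Fin n → Type} [∀ i, Ring (A i)] [∀ i, Algebra ℚ (A i)]
    (S : Subring (∀ i, A i)) [Finite (↥S)ˣ] (hS : IsOrderIn S) (i : Fin n) [Nontrivial (A i)]
    (K : Type) [Field K] [inst : Algebra ℚ K] [FiniteDimensional ℚ K] (f : K →+* A i) : 
    Module.finrank ℚ K = 1 ∨ (Module.finrank ℚ K = 2 ∧ IsEmpty (K →+* ℝ)) := by
  haveI : CharZero K := algebraRat.charZero K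
  obtain rfl : inst = DivisionRing.toRatAlgebra := Subsingleton.elim _ _
  haveI : NumberField K := ⟨⟩
  exact finrank_of_rank_zero K (rank_eq_zero_of_finite S hS i K f)

/-- Every finite-dimensional field mapping to `D` is `ℚ` or imaginary quadratic. -/
def SubfieldCond (D : Type) [Ring D] : Prop :=
  ∀ (K : Type) [Field K] [Algebra ℚ K] [FiniteDimensional ℚ K], (K →+* D) →
    Module.finrank ℚ K = 1 ∨ (Module.finrank ℚ K = 2 ∧ IsEmpty (K →+* ℝ))

lemma finrank_of_comm {D : Type} [Ring D] (P : SubfieldCond D) (R : Type) [Ring R] [IsDomain R]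
    [Algebra ℚ R] [FiniteDimensional ℚ R] (hc : ∀ x y : R, x * y = y * x) (f : R →+* D) :
    Module.finrank ℚ R = 1 ∨ Module.finrank ℚ R = 2 := by
  let cr : CommRing R := { ‹Ring R› with mul_comm := hc }
  let fl : Field R := fieldOfFiniteDimensional ℚ R
  rcases P R f with h | h
  · exact Or.inl h
  · exact Or.inr h.1

lemma neg_of_sq {D : Type} [Ring D] [IsDomain D] [Algebra ℚ D] (P : SubfieldCond D)
    (x : D) (hx : ∀ r : ℚ, x ≠ algebraMap ℚ D r) (a : ℚ) (h : x * x = algebraMap ℚ D a) :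
    a < 0 := by
  by_contra! ha
  have : Fact (∀ r : ℚ, r ^ 2 ≠ a + 0 * r) := ⟨by
    intro r hr
    have h1 : (x - algebraMap ℚ D r) * (x + algebraMap ℚ D r) = 0 := by
      rw [sub_mul, mul_add, mul_add, ← Algebra.commutes r x, h, ← map_mul,
        show r * r = a by linear_combination hr]
      abel
    rcases mul_eq_zero.1 h1 with h2 | h2
    · exact hx r (sub_eq_zero.1 h2)
    · exact hx (-r) (by rw [map_neg]; exact eq_neg_of_add_eq_zero_left h2)⟩
  have f : QuadraticAlgebra ℚ a 0 →ₐ[ℚ] D :=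
    QuadraticAlgebra.lift ⟨x, by rw [h, zero_smul, add_zero, Algebra.algebraMap_eq_smul_one]⟩
  have g : QuadraticAlgebra ℚ a 0 →ₐ[ℚ] ℝ :=
    QuadraticAlgebra.lift ⟨Real.sqrt a, by
      rw [Real.mul_self_sqrt (by exact_mod_cast ha), zero_smul, add_zero,
        ← Algebra.algebraMap_eq_smul_one]; simp⟩
  have h2 : Module.finrank ℚ (QuadraticAlgebra ℚ a 0) = 2 := QuadraticAlgebra.finrank_eq_two _ _
  have : FiniteDimensional ℚ (QuadraticAlgebra ℚ a 0) :=
    FiniteDimensional.of_finrank_pos (by omega)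
  rcases P (QuadraticAlgebra ℚ a 0) f.toRingHom with h3 | h3
  · omega
  · exact h3.2.false g.toRingHom

lemma mem_span_of_commute {D : Type} [Ring D] [IsDomain D] [Algebra ℚ D] [FiniteDimensional ℚ D]
    (P : SubfieldCond D) (x y : D) (hx : ∀ r : ℚ, x ≠ algebraMap ℚ D r) (hxy : x * y = y * x) :
    ∃ c d : ℚ, y = c • (1 : D) + d • x := by
  have hcomm := Algebra.isMulCommutative_adjoin ℚ (s := ({x, y} : Set D)) (by
    rintro a (rfl | rfl) b (rfl | rfl) <;> simp [hxy])
  set L := Algebra.adjoin ℚ ({x, y} : Set D) with hL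
  have hxL : x ∈ L := Algebra.subset_adjoin (by simp)
  have hyL : y ∈ L := Algebra.subset_adjoin (by simp)
  have hc : ∀ a b : L, a * b = b * a := fun a b => hcomm.is_comm.comm a b
  have h1 : Module.finrank ℚ L ≠ 1 := by
    intro h
    have := Subalgebra.eq_bot_of_finrank_one h
    rw [this] at hxL
    obtain ⟨r, hr⟩ := Algebra.mem_bot.1 hxL
    exact hx r hr.symm
  have h2 : Module.finrank ℚ L = 2 := by
    rcases finrank_of_comm P L hc L.val.toRingHom with h | h
    · exact absurd h h1
    · exact h
  have hli : LinearIndependent ℚ ![(1 : L), ⟨x, hxL⟩] := by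
    rw [LinearIndependent.pair_iff]
    intro s t hst
    have hst' : s • (1 : D) + t • x = 0 := congrArg Subtype.val hst
    have ht : t = 0 := by
      by_contra ht
      apply hx (-(t⁻¹ * s))
      have h3 := congrArg (fun z => t⁻¹ • z) hst'
      simp only [smul_add, smul_smul, inv_mul_cancel₀ ht, one_smul, smul_zero] at h3
      rw [map_neg, Algebra.algebraMap_eq_smul_one]
      exact eq_neg_of_add_eq_zero_right h3
    refine ⟨?_, ht⟩
    rw [ht, zero_smul, add_zero] at hst'
    simpa using hst'
  have hsp := hli.span_eq_top_of_card_eq_finrank (by rw [h2]; simp)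
  have hy : (⟨y, hyL⟩ : L) ∈ Submodule.span ℚ (Set.range ![(1 : L), ⟨x, hxL⟩]) := by
    rw [hsp]; trivial
  rw [Matrix.range_cons, Matrix.range_cons, Matrix.range_empty, Set.union_empty,
    Set.singleton_union, Submodule.mem_span_pair] at hy
  obtain ⟨c, d, hcd⟩ := hy
  exact ⟨c, d, (congrArg Subtype.val hcd).symm⟩

lemma quaternion_of_basis {D : Type} [Ring D] [Nontrivial D] [Algebra ℚ D] {a b : ℚ} (ha : a < 0)
    (hb : b < 0) (Q : QuaternionAlgebra.Basis D a 0 b)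
    (hsurj : Function.Surjective Q.liftHom) : Nonempty (D ≃+* ℍ[ℚ, a, b]) := by
  have hinj : Function.Injective Q.liftHom := by
    rw [injective_iff_map_eq_zero]
    intro q hq
    have h1 : q * star q = algebraMap ℚ ℍ[ℚ, a, b]
        (q.re ^ 2 + (-a) * q.imI ^ 2 + (-b) * q.imJ ^ 2 + (a * b) * q.imK ^ 2) := by
      ext <;> simp [QuaternionAlgebra.algebraMap_eq] <;> ring
    have h2 := congrArg Q.liftHom h1
    rw [map_mul, hq, zero_mul, AlgHom.commutes] at h2
    have h3 := (algebraMap ℚ D).injective (h2.symm.trans (map_zero (algebraMap ℚ D)).symm)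
    have ha' : 0 < -a := neg_pos.2 ha
    have hb' : 0 < -b := neg_pos.2 hb
    have hab : 0 < a * b := mul_pos_of_neg_of_neg ha hb
    have p1 := sq_nonneg q.re
    have p2 := mul_nonneg ha'.le (sq_nonneg q.imI)
    have p3 := mul_nonneg hb'.le (sq_nonneg q.imJ)
    have p4 := mul_nonneg hab.le (sq_nonneg q.imK)
    have q1 : q.re ^ 2 = 0 := by linarith
    have q2 : -a * q.imI ^ 2 = 0 := by linarith
    have q3 : -b * q.imJ ^ 2 = 0 := by linarith
    have q4 : a * b * q.imK ^ 2 = 0 := by linarith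
    have r1 := pow_eq_zero_iff (two_ne_zero) |>.1 q1
    have r2 := pow_eq_zero_iff (two_ne_zero) |>.1 ((mul_eq_zero.1 q2).resolve_left ha'.ne')
    have r3 := pow_eq_zero_iff (two_ne_zero) |>.1 ((mul_eq_zero.1 q3).resolve_left hb'.ne')
    have r4 := pow_eq_zero_iff (two_ne_zero) |>.1 ((mul_eq_zero.1 q4).resolve_left hab.ne')
    ext <;> simp [r1, r2, r3, r4]
  exact ⟨(RingEquiv.ofBijective Q.liftHom ⟨hinj, hsurj⟩).symm⟩

lemma classify_noncomm {D : Type} [Ring D] [IsDomain D] [Algebra ℚ D] [FiniteDimensional ℚ D]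
    (P : SubfieldCond D) (α y : D) (hαy : α * y ≠ y * α) :
    ∃ a b : ℚ, a < 0 ∧ b < 0 ∧ Nonempty (D ≃+* ℍ[ℚ, a, b]) := by
  have hα : ∀ r : ℚ, α ≠ algebraMap ℚ D r := by
    rintro r rfl; exact hαy (Algebra.commutes r y)
  obtain ⟨c, d, hcd⟩ := mem_span_of_commute P α (α * α) hα (mul_assoc _ _ _).symm
  obtain ⟨i, hi⟩ : ∃ i, i = α - algebraMap ℚ D (d / 2) := ⟨_, rfl⟩
  have hiy : i * y ≠ y * i := by
    intro h
    apply hαy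
    rw [hi, sub_mul, mul_sub, Algebra.commutes] at h
    exact sub_left_injective h
  have hi' : ∀ r : ℚ, i ≠ algebraMap ℚ D r := by
    rintro r rfl; exact hiy (Algebra.commutes r y)
  obtain ⟨a, hii⟩ : ∃ a : ℚ, i * i = algebraMap ℚ D a := by
    refine ⟨c + d ^ 2 / 4, ?_⟩
    rw [hi, sub_mul, mul_sub, mul_sub, hcd, ← Algebra.commutes (d / 2) α, ← map_mul,
      Algebra.algebraMap_eq_smul_one, Algebra.algebraMap_eq_smul_one,
      Algebra.algebraMap_eq_smul_one, smul_mul_assoc, one_mul]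
    module
  have ha := neg_of_sq P i hi' a hii
  have ha0 : algebraMap ℚ D a ≠ 0 := by simpa using ha.ne
  have hi0 : i ≠ 0 := by simpa using hi' 0
  have hcom : ∀ (z : D), algebraMap ℚ D a * z = z * algebraMap ℚ D a := Algebra.commutes a
  obtain ⟨j, hj⟩ : ∃ j, j = i * y - y * i := ⟨_, rfl⟩
  have hj0 : j ≠ 0 := by rw [hj]; exact sub_ne_zero.2 hiy
  have hji : j * i = -(i * j) := by
    rw [hj, sub_mul, mul_sub, mul_assoc y i i, ← mul_assoc i i y, hii, hcom]
    noncomm_ring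
  have hij0 : i * j ≠ 0 := mul_ne_zero hi0 hj0
  have hne : j * i ≠ i * j := by
    rw [hji]
    intro h
    have h2 : (2 : ℚ) • (i * j) = 0 := by
      rw [two_smul]; nth_rewrite 1 [← h]; exact neg_add_cancel _
    exact hij0 ((smul_eq_zero.1 h2).resolve_left two_ne_zero)
  have hj' : ∀ r : ℚ, j ≠ algebraMap ℚ D r := by
    intro r hr; apply hne; rw [hr]; exact Algebra.commutes r i
  have hanti : ∀ z, z * i = -(i * z) → i * (z * j) = (z * j) * i := by
    intro z hz
    rw [mul_assoc, hji, mul_neg, ← mul_assoc, ← mul_assoc, hz, neg_mul, neg_neg]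
  obtain ⟨b, hjj⟩ : ∃ b : ℚ, j * j = algebraMap ℚ D b := by
    obtain ⟨c', d', h⟩ := mem_span_of_commute P i (j * j) hi' (hanti j hji)
    have h2 : j * (j * j) = (j * j) * j := (mul_assoc _ _ _).symm
    rw [h, mul_add, add_mul, mul_smul_comm, mul_smul_comm, smul_mul_assoc, smul_mul_assoc,
      mul_one, one_mul] at h2
    have h3 := add_left_cancel h2
    have hd : d' = 0 := by
      by_contra hd
      exact hne (smul_right_injective D hd h3)
    exact ⟨c', by rw [h, hd, zero_smul, add_zero, Algebra.algebraMap_eq_smul_one]⟩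
  have hb := neg_of_sq P j hj' b hjj
  refine ⟨a, b, ha, hb, ?_⟩
  let Q : QuaternionAlgebra.Basis D a 0 b :=
    { i := i
      j := j
      k := i * j
      i_mul_i := by rw [hii, zero_smul, add_zero, Algebra.algebraMap_eq_smul_one]
      j_mul_j := by rw [hjj, Algebra.algebraMap_eq_smul_one]
      i_mul_j := rfl
      j_mul_i := by rw [hji, zero_smul, zero_sub] }
  refine quaternion_of_basis ha hb Q ?_
  intro z
  have hiiz : ∀ w, i * (i * w) = a • w := fun w => by
    rw [← mul_assoc, hii, Algebra.smul_def]
  have hzii : ∀ w, w * i * i = a • w := fun w => by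
    rw [mul_assoc, hii, ← Algebra.commutes, Algebra.smul_def]
  have hp : i * (a • z + i * z * i) = (a • z + i * z * i) * i := by
    rw [mul_add, add_mul, hzii, mul_assoc i z i, hiiz, mul_smul_comm, smul_mul_assoc, add_comm]
  have hm : (a • z - i * z * i) * i = -(i * (a • z - i * z * i)) := by
    rw [mul_sub, sub_mul, hzii, mul_assoc i z i, hiiz, mul_smul_comm, smul_mul_assoc, neg_sub]
  obtain ⟨c1, d1, h1⟩ := mem_span_of_commute P i _ hi' hp
  obtain ⟨c2, d2, h2⟩ := mem_span_of_commute P i _ hi' (hanti _ hm)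
  have h3 := congrArg (fun w => w * j) h2
  simp only [mul_assoc _ j j, hjj] at h3
  rw [← Algebra.commutes, ← Algebra.smul_def, add_mul, smul_mul_assoc, smul_mul_assoc,
    one_mul] at h3
  have h4 : (2 * a * b) • z = (b * c1) • (1 : D) + (b * d1) • i + c2 • j + d2 • (i * j) := by
    have : (2 * a * b) • z = b • (a • z + i * z * i) + b • (a • z - i * z * i) := by module
    rw [this, h1, h3]; module
  have hab : 2 * a * b ≠ 0 := mul_ne_zero (mul_ne_zero two_ne_zero ha.ne) hb.ne
  refine ⟨(2 * a * b)⁻¹ • ⟨b * c1, b * d1, c2, d2⟩, ?_⟩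
  rw [map_smul]
  have h5 : Q.liftHom ⟨b * c1, b * d1, c2, d2⟩ = (2 * a * b) • z := by
    rw [h4]
    change algebraMap ℚ D (b * c1) + (b * d1) • i + c2 • j + d2 • (i * j) = _
    rw [Algebra.algebraMap_eq_smul_one]
  rw [h5, smul_smul, inv_mul_cancel₀ hab, one_smul]

lemma classify {D : Type} [Ring D] [IsDomain D] [Algebra ℚ D] [FiniteDimensional ℚ D]
    (P : SubfieldCond D) :
    Nonempty (D ≃+* ℚ) ∨
      (∃ (K : Type) (_ : Field K) (_ : Algebra ℚ K),
        Module.finrank ℚ K = 2 ∧ IsEmpty (K →+* ℝ) ∧ Nonempty (D ≃+* K)) ∨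
      (∃ a b : ℚ, a < 0 ∧ b < 0 ∧ Nonempty (D ≃+* ℍ[ℚ, a, b])) := by
  by_cases hc : ∀ x y : D, x * y = y * x
  · by_cases h1 : Module.finrank ℚ D = 1
    · left
      have hbt : (⊥ : Subalgebra ℚ D) = ⊤ := Subalgebra.bot_eq_top_of_finrank_eq_one h1
      have hb : Function.Bijective (algebraMap ℚ D) := by
        refine ⟨(algebraMap ℚ D).injective, fun x => ?_⟩
        have : x ∈ (⊥ : Subalgebra ℚ D) := by rw [hbt]; trivial
        exact Algebra.mem_bot.1 this
      exact ⟨(RingEquiv.ofBijective _ hb).symm⟩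
    · right; left
      let cr : CommRing D := { ‹Ring D› with mul_comm := hc }
      let fl : Field D := fieldOfFiniteDimensional ℚ D
      rcases P D (RingHom.id D) with h | h
      · exact absurd h h1
      · exact ⟨D, fl, inferInstance, h.1, h.2, ⟨RingEquiv.refl D⟩⟩
  · push Not at hc
    obtain ⟨x, y, hxy⟩ := hc
    exact Or.inr (Or.inr (classify_noncomm P x y hxy))

lemma isDomain_of_reduced {A : Type} [Ring A] [IsSimpleRing A] [Algebra ℚ A]
    [FiniteDimensional ℚ A] (h : ∀ x : A, x * x = 0 → x = 0) : IsDomain A := by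
  have : IsArtinianRing A := IsArtinianRing.of_finite ℚ A
  obtain ⟨n, hn, D, _, _, _, ⟨e⟩⟩ := IsSimpleRing.exists_algEquiv_matrix_divisionRing_finite ℚ A
  by_cases h1 : n = 1
  · subst h1
    exact (e.toRingEquiv.trans Matrix.uniqueRingEquiv).toMulEquiv.isDomain
  · exfalso
    have hn0 : n ≠ 0 := hn.out
    let p : Fin n := ⟨0, by omega⟩
    let q : Fin n := ⟨1, by omega⟩
    have hpq : q ≠ p := by simp [p, q, Fin.ext_iff]
    have h2 : Matrix.single p q (1 : D) * Matrix.single p q (1 : D) = 0 := by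
      simp [hpq]
    have h3 := h (e.symm (Matrix.single p q (1 : D))) (by rw [← map_mul, h2, map_zero])
    rw [EmbeddingLike.map_eq_zero_iff] at h3
    have := congrFun (congrFun h3 p) q
    simp at this

/-- Let `A₁, …, Aₙ` be finite-dimensional simple `ℚ`-algebras and
`S` an order in `A = A₁ × ⋯ × Aₙ`. Then `Sˣ` is finite iff each `Aᵢ` is isomorphic
to `ℚ`, to an imaginary quadratic field, or to a totally definite quaternion
algebra `(a,b/ℚ)` with `a < 0` and `b < 0`. -/
theorem units_of_order_finite_iff
    (n : ℕ) (A : Fin n → Type) [∀ i, Ring (A i)] [∀ i, Algebra ℚ (A i)]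
    [∀ i, FiniteDimensional ℚ (A i)] (hsimple : ∀ i, IsSimpleRing (A i))
    (S : Subring (∀ i, A i)) (hS : IsOrderIn S) :
    Finite (↥S)ˣ ↔ ∀ i,
      Nonempty (A i ≃+* ℚ) ∨
      (∃ (K : Type) (_ : Field K) (_ : Algebra ℚ K),
        Module.finrank ℚ K = 2 ∧ IsEmpty (K →+* ℝ) ∧ Nonempty (A i ≃+* K)) ∨
      (∃ a b : ℚ, a < 0 ∧ b < 0 ∧ Nonempty (A i ≃+* ℍ[ℚ, a, b])) := by
  constructor
  · intro hfin i
    have := hsimple i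
    have hred : ∀ x : A i, x * x = 0 → x = 0 := by
      intro x hx
      have h := eq_zero_of_sq_zero S hS (Pi.single i x) (by
        rw [← Pi.single_mul, hx, Pi.single_zero])
      simpa using h
    have := isDomain_of_reduced hred
    exact classify (fun K _ _ _ f => finrank_of_hom S hS i K f)
  · intro h
    refine finite_units_pi S (fun i => ?_)
    have := hsimple i
    have hT : (S.map (Pi.evalRingHom A i)).toAddSubgroup.FG := by
      rw [AddSubgroup.fg_iff_addSubmonoid_fg]
      exact AddSubmonoid.FG.map ((AddSubgroup.fg_iff_addSubmonoid_fg _).1 hS.1)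
        (Pi.evalRingHom A i).toAddMonoidHom
    rcases h i with ⟨⟨e⟩⟩ | ⟨K, _, _, h2, hR, ⟨e⟩⟩ | ⟨a, b, ha, hb, ⟨e⟩⟩
    · exact finite_units_rat e _ hT
    · exact finite_units_quadratic h2 hR e _ hT
    · exact finite_units_quaternion ha hb e _ hT
end

section
/- Let A₁, …, Aₙ be finite-dimensional simple ℚ-algebras and let S be an order in the product A = A₁ × ⋯ × Aₙ. Then the group of units S* is virtually abelian if and only if for each i, the algebra Aᵢ is either commutative (a number field) or a totally definite quaternion algebra. -/
open Quaternion

/-- A totally definite quaternion algebra: a quaternion algebra `(a,b/K)` over a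
totally real number field `K` with `σ a < 0` and `σ b < 0` for every real
embedding `σ : K → ℝ`. -/
def IsTotallyDefiniteQuaternionAlgebra (B : Type) [Ring B] : Prop :=
  ∃ (K : Type) (_ : Field K) (_ : Algebra ℚ K), FiniteDimensional ℚ K ∧
    (∀ σ : K →+* ℂ, ∀ x : K, (σ x).im = 0) ∧
    ∃ a b : K, a ≠ 0 ∧ b ≠ 0 ∧ (∀ σ : K →+* ℝ, σ a < 0 ∧ σ b < 0) ∧
      Nonempty (B ≃+* ℍ[K, a, b])

open NumberField
theorem den {A : Type} [Ring A] [Algebra ℚ A] (S : Subring A)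
    (h : Submodule.span ℚ (S : Set A) = ⊤) (x : A) : ∃ m : ℕ, 0 < m ∧ m • x ∈ S := by
  have hx : x ∈ Submodule.span ℚ (S : Set A) := h ▸ Submodule.mem_top
  induction hx using Submodule.span_induction with
  | mem x hx => exact ⟨1, one_pos, by simpa using hx⟩
  | zero => exact ⟨1, one_pos, by simp⟩
  | add x y _ _ hx hy =>
    obtain ⟨m, hm, hx⟩ := hx
    obtain ⟨k, hk, hy⟩ := hy
    refine ⟨m * k, by positivity, ?_⟩
    rw [smul_add]
    refine S.add_mem ?_ ?_
    · rw [mul_comm, mul_smul]; exact nsmul_mem hx k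
    · rw [mul_smul]; exact nsmul_mem hy m
  | smul q x _ hx =>
    obtain ⟨m, hm, hx⟩ := hx
    refine ⟨m * q.den, by have := q.den_pos; positivity, ?_⟩
    have : (m * q.den) • q • x = q.num • (m • x) := by
      rw [← Int.cast_smul_eq_zsmul ℚ q.num, ← Nat.cast_smul_eq_nsmul ℚ m,
        ← Nat.cast_smul_eq_nsmul ℚ (m * q.den), smul_smul, smul_smul]
      congr 1
      push_cast
      rw [mul_assoc, Rat.den_mul_eq_num, mul_comm]
    rw [this]
    exact zsmul_mem hx _

/-- powers commute -/
theorem pow_comm_of_virt {G : Type} [Group G] (h : ∃ H : Subgroup G, H.FiniteIndex ∧ ∀ x y : H, x * y = y * x)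
    (u v : G) : ∃ k : ℕ, 0 < k ∧ Commute (u ^ k) (v ^ k) := by
  obtain ⟨H, hH, hc⟩ := h
  obtain ⟨a, ha, -, hua⟩ := Subgroup.exists_pow_mem_of_index_ne_zero hH.index_ne_zero u
  obtain ⟨b, hb, -, hvb⟩ := Subgroup.exists_pow_mem_of_index_ne_zero hH.index_ne_zero v
  refine ⟨a * b, by positivity, ?_⟩
  have h1 : u ^ (a * b) ∈ H := by rw [pow_mul]; exact H.pow_mem hua _
  have h2 : v ^ (a * b) ∈ H := by rw [mul_comm, pow_mul]; exact H.pow_mem hvb _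
  exact congrArg Subtype.val (hc ⟨_, h1⟩ ⟨_, h2⟩)

/-- square-zero elements commute -/
theorem sq_zero_comm {A : Type} [Ring A] [Algebra ℚ A] (S : Subring A)
    (hS : Submodule.span ℚ (S : Set A) = ⊤)
    (h : ∃ H : Subgroup (↥S)ˣ, H.FiniteIndex ∧ ∀ x y : H, x * y = y * x)
    (x y : A) (hx : x * x = 0) (hy : y * y = 0) : x * y = y * x := by
  have key : ∀ x : A, x * x = 0 → ∃ m : ℕ, 0 < m ∧ ∃ u : (↥S)ˣ, ∀ k : ℕ,
      (((u ^ k : (↥S)ˣ) : S) : A) = 1 + (k * m) • x := by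
    intro x hx
    obtain ⟨m, hm, hmx⟩ := den S hS x
    have e : (m • x) * (m • x) = 0 := by rw [smul_mul_smul_comm, hx, smul_zero]
    refine ⟨m, hm, ⟨⟨1 + m • x, S.add_mem S.one_mem hmx⟩, ⟨1 - m • x, S.sub_mem S.one_mem hmx⟩, ?_, ?_⟩, ?_⟩
    · ext
      simp only [Subring.coe_mul, Subring.coe_one, mul_sub, add_mul, mul_one, one_mul, e]
      abel
    · ext
      simp only [Subring.coe_mul, Subring.coe_one, mul_add, sub_mul, mul_one, one_mul, e]
      abel
    intro k
    induction k with
    | zero => simp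
    | succ k ih =>
      rw [pow_succ, Units.val_mul, Subring.coe_mul, ih]
      have e2 : ((k * m) • x) * (m • x) = 0 := by rw [smul_mul_smul_comm, hx, smul_zero]
      simp only [mul_add, add_mul, mul_one, one_mul, e2, add_smul]
      abel
  obtain ⟨m, hm, u, hu⟩ := key x hx
  obtain ⟨l, hl, v, hv⟩ := key y hy
  obtain ⟨k, hk, hc⟩ := pow_comm_of_virt h u v
  have hc' := congrArg (fun w : (↥S)ˣ => ((w : S) : A)) hc.eq
  simp only [Units.val_mul, Subring.coe_mul, hu, hv] at hc'
  have h3 : ((k * m) * (k * l)) • (x * y) = ((k * m) * (k * l)) • (y * x) := by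
    have e1 : (((k * m) • x) * ((k * l) • y)) = (((k * l) • y) * ((k * m) • x)) := by
      simp only [mul_add, add_mul, one_mul, mul_one] at hc'
      have := sub_eq_zero.mpr hc'
      rw [← sub_eq_zero, ← this]; abel
    rw [smul_mul_smul_comm, smul_mul_smul_comm, mul_comm (k * l)] at e1
    exact e1
  rw [← Nat.cast_smul_eq_nsmul ℚ, ← Nat.cast_smul_eq_nsmul ℚ (k * m * (k * l))] at h3
  exact smul_right_injective A (r := ((k * m * (k * l) : ℕ) : ℚ)) (by positivity) h3


/-- powers of units of `𝓞 L` land in the order -/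
theorem unit_pow_mem {n : ℕ} (A : Fin n → Type) [∀ i, Ring (A i)] [∀ i, Algebra ℚ (A i)]
    (S : Subring (∀ i, A i)) (hden : ∀ x : (∀ i, A i), ∃ m : ℕ, 0 < m ∧ m • x ∈ S) (i : Fin n)
    (L : Type) [Field L] [NumberField L] (f : L →+* A i) (u : (𝓞 L)ˣ) :
    ∃ k : ℕ, 0 < k ∧ ∃ w : (↥S)ˣ, ((w : S) : ∀ i, A i) i = f ((u : 𝓞 L) : L) ^ k := by
  classical
  -- common denominator
  have hcd : ∃ m : ℕ, 0 < m ∧ ∀ x : 𝓞 L, m • (Pi.single i (f (x : L)) : ∀ i, A i) ∈ S := by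
    have hfg : (⊤ : Submodule ℤ (𝓞 L)).FG := Module.Finite.fg_top
    obtain ⟨T, hT⟩ := hfg
    choose d hd hdS using fun x : 𝓞 L => hden (Pi.single i (f (x : L)))
    refine ⟨∏ t ∈ T, d t, Finset.prod_pos fun t _ => hd t, ?_⟩
    intro x
    have hx : x ∈ Submodule.span ℤ (T : Set (𝓞 L)) := hT ▸ Submodule.mem_top
    induction hx using Submodule.span_induction with
    | mem x hx =>
      rw [← Finset.prod_erase_mul T d hx, mul_smul]
      exact nsmul_mem (hdS x) _
    | zero => simp
    | add x y _ _ hx hy =>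
      have := S.add_mem hx hy
      rwa [← smul_add, ← Pi.single_add, ← map_add] at this
    | smul a x _ hx =>
      have := zsmul_mem hx a
      rw [smul_comm, ← Pi.single_smul, ← map_zsmul] at this
      simpa using this
  obtain ⟨m, hm, hmS⟩ := hcd
  let I : Ideal (𝓞 L) := Ideal.span {(m : 𝓞 L)}
  have hI : I ≠ ⊥ := by
    simp only [I, ne_eq, Ideal.span_singleton_eq_bot]
    exact_mod_cast hm.ne'
  have : Finite (𝓞 L ⧸ I) := Ideal.finiteQuotientOfFreeOfNeBot I hI
  let ub : (𝓞 L ⧸ I)ˣ := Units.map (Ideal.Quotient.mk I).toMonoidHom u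
  obtain ⟨k, hk, hk1⟩ := isOfFinOrder_iff_pow_eq_one.mp (isOfFinOrder_of_finite ub)
  have key : ∀ v : (𝓞 L)ˣ, Units.map (Ideal.Quotient.mk I).toMonoidHom v = 1 →
      Pi.mulSingle i (f ((v : 𝓞 L) : L)) ∈ S := by
    intro v hv
    have h1 : (Ideal.Quotient.mk I) (v : 𝓞 L) = Ideal.Quotient.mk I 1 := by
      have := congrArg Units.val hv
      simpa using this
    rw [Ideal.Quotient.eq, Ideal.mem_span_singleton] at h1
    obtain ⟨c, hc⟩ := h1
    have h2 : (v : 𝓞 L) = 1 + m • c := by rw [nsmul_eq_mul, ← hc]; ring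
    have h3 : (Pi.mulSingle i (f ((v : 𝓞 L) : L)) : ∀ i, A i) = 1 + m • Pi.single i (f (c : L)) := by
      funext j
      by_cases hj : j = i
      · subst hj
        simp [h2]
      · simp [hj]
    rw [h3]
    exact S.add_mem S.one_mem (hmS c)
  have m1 := key (u ^ k) (by rw [map_pow]; exact hk1)
  have m2 := key (u ^ k)⁻¹ (by rw [map_inv, map_pow]; exact inv_eq_one.mpr hk1)
  refine ⟨k, hk, ⟨⟨_, m1⟩, ⟨_, m2⟩, ?_, ?_⟩, ?_⟩
  · ext1
    rw [Subring.coe_mul, ← Pi.mulSingle_mul, ← map_mul, ← map_mul, Units.mul_inv]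
    simp
  · ext1
    rw [Subring.coe_mul, ← Pi.mulSingle_mul, ← map_mul, ← map_mul, Units.inv_mul]
    simp
  · simp

/-- a unit has a central power -/
theorem central_pow {D : Type} [DivisionRing D] [Algebra ℚ D] [FiniteDimensional ℚ D]
    (P : ∀ (L : Type) [Field L] [NumberField L] (f g : L →+* D) (u : (𝓞 L)ˣ),
      ∃ k : ℕ, 0 < k ∧ Commute (f ((u : 𝓞 L) : L) ^ k) (g ((u : 𝓞 L) : L) ^ k))
    (L : Type) [Field L] [NumberField L] (f : L →+* D) (u : (𝓞 L)ˣ) :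
    ∃ k : ℕ, 0 < k ∧ ∀ y : D, Commute (f ((u : 𝓞 L) : L) ^ k) y := by
  set x : D := f ((u : 𝓞 L) : L) with hxdef
  -- conjugates
  have hconj : ∀ g : D, g ≠ 0 → ∃ F : L →+* D, ∀ z, F z = g * f z * g⁻¹ := by
    intro g hg
    refine ⟨{ toFun := fun z => g * f z * g⁻¹, map_one' := by simp [hg], map_zero' := by simp,
              map_add' := by intro a b; simp [mul_add, add_mul], 
              map_mul' := by
                intro a b
                rw [map_mul]
                simp only [mul_assoc]
                rw [inv_mul_cancel_left₀ hg] }, fun z => rfl⟩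
  have hone : ∀ g : D, ∃ k : ℕ, 0 < k ∧ Commute (x ^ k) g := by
    intro g
    by_cases hg : g = 0
    · exact ⟨1, one_pos, by rw [hg]; exact Commute.zero_right _⟩
    by_cases hg1 : 1 + g = 0
    · refine ⟨1, one_pos, ?_⟩
      rw [show g = -1 by rw [eq_neg_iff_add_eq_zero, add_comm]; exact hg1]
      exact Commute.neg_one_right _
    obtain ⟨F, hF⟩ := hconj g hg
    obtain ⟨G, hG⟩ := hconj _ hg1
    obtain ⟨k1, hk1, h1⟩ := P L f F u
    obtain ⟨k2, hk2, h2⟩ := P L f G u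
    obtain ⟨k3, hk3, h3⟩ := P L F G u
    let k := k1 * k2 * k3
    have hk : 0 < k := by positivity
    refine ⟨k, hk, ?_⟩
    set a := x ^ k with ha
    set b := F ((u : 𝓞 L) : L) ^ k with hb
    set c := G ((u : 𝓞 L) : L) ^ k with hc
    have hab : Commute a b := by
      have := h1.pow_pow (k2 * k3) (k2 * k3)
      rw [← pow_mul, ← pow_mul] at this
      simpa only [ha, hb, k, mul_assoc] using this
    have hac : Commute a c := by
      have := h2.pow_pow (k1 * k3) (k1 * k3)
      rw [← pow_mul, ← pow_mul, show k2 * (k1 * k3) = k by simp only [k]; ring] at this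
      exact this
    have hbc : Commute b c := by
      have := h3.pow_pow (k1 * k2) (k1 * k2)
      rw [← pow_mul, ← pow_mul, show k3 * (k1 * k2) = k by simp only [k]; ring] at this
      exact this
    have eb : b * g = g * a := by
      rw [hb, ← map_pow F, hF, ha, hxdef, ← map_pow f, mul_assoc, inv_mul_cancel₀ hg, mul_one]
    have ec : c * (1 + g) = (1 + g) * a := by
      rw [hc, ← map_pow G, hG, ha, hxdef, ← map_pow f, mul_assoc, inv_mul_cancel₀ hg1, mul_one]
    have e : (b - c) * g = c - a := by
      rw [sub_mul, eb]
      rw [mul_add, add_mul, mul_one, one_mul] at ec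
      rw [sub_eq_sub_iff_add_eq_add, add_comm, ← ec]
    by_cases hbc0 : b - c = 0
    · rw [hbc0, zero_mul] at e
      have h4 : b = a := by rw [sub_eq_zero.mp hbc0]; exact sub_eq_zero.mp e.symm
      rw [h4] at eb
      exact eb
    · have h5 : g = (b - c)⁻¹ * (c - a) := by rw [← e, inv_mul_cancel_left₀ hbc0]
      rw [h5]
      exact ((hab.sub_right hac).inv_right₀).mul_right (hac.sub_right (Commute.refl a))
  choose k hk hkc using hone
  let B := Module.finBasis ℚ D
  refine ⟨∏ j, k (B j), Finset.prod_pos fun j _ => hk _, ?_⟩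
  intro y
  rw [← B.sum_repr y]
  refine Commute.sum_right _ _ _ fun j _ => ?_
  refine Commute.smul_right ?_ _
  rw [← Finset.mul_prod_erase Finset.univ _ (Finset.mem_univ j), pow_mul]
  exact (hkc (B j)).pow_left _


theorem rank_lemma (K L : Type) [Field K] [Field L] [NumberField K] [NumberField L] [Algebra K L]
    (h : ∀ u : (𝓞 L)ˣ, ∃ k : ℕ, 0 < k ∧ ∃ w : K, algebraMap K L w = ((u : 𝓞 L) : L) ^ k)
    (hd : 2 ≤ Module.finrank K L) :
    IsTotallyReal K ∧ IsTotallyComplex L ∧ Module.finrank K L = 2 := by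
  let φ : (𝓞 K)ˣ →* (𝓞 L)ˣ := Units.map (algebraMap (𝓞 K) (𝓞 L)).toMonoidHom
  let ψ : Additive (𝓞 K)ˣ →ₗ[ℤ] Additive (𝓞 L)ˣ := (MonoidHom.toAdditive φ).toIntLinearMap
  have hφ : Function.Injective φ := Units.map_injective (FaithfulSMul.algebraMap_injective (𝓞 K) (𝓞 L))
  have hψ : Function.Injective ψ := hφ
  have hran : ∀ v : (𝓞 L)ˣ, (∃ w : K, algebraMap K L w = ((v : 𝓞 L) : L)) → ∃ w, φ w = v := by
    intro v ⟨w, hw⟩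
    have hw0 : w ≠ 0 := by
      rintro rfl
      rw [map_zero] at hw
      exact v.ne_zero (by ext1; simpa using hw.symm)
    have i1 : IsIntegral ℤ w := by
      rw [← isIntegral_algebraMap_iff (FaithfulSMul.algebraMap_injective K L), hw]
      exact RingOfIntegers.isIntegral_coe _
    have i2 : IsIntegral ℤ w⁻¹ := by
      rw [← isIntegral_algebraMap_iff (FaithfulSMul.algebraMap_injective K L), map_inv₀, hw]
      have : ((v : 𝓞 L) : L)⁻¹ = ((v⁻¹ : (𝓞 L)ˣ) : 𝓞 L) := by
        rw [inv_eq_iff_eq_inv]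
        refine eq_inv_of_mul_eq_one_left ?_
        rw [← map_mul, Units.mul_inv, map_one]
      rw [this]
      exact RingOfIntegers.isIntegral_coe _
    refine ⟨⟨⟨w, i1⟩, ⟨w⁻¹, i2⟩, ?_, ?_⟩, ?_⟩
    · ext1; exact mul_inv_cancel₀ hw0
    · ext1; exact inv_mul_cancel₀ hw0
    · ext1; ext1; exact hw
  have htor : Module.IsTorsion ℤ (Additive (𝓞 L)ˣ ⧸ LinearMap.range ψ) := by
    intro x
    obtain ⟨u, rfl⟩ := Submodule.Quotient.mk_surjective _ x
    obtain ⟨k, hk, w, hw⟩ := h u.toMul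
    obtain ⟨w', hw'⟩ := hran (u.toMul ^ k) ⟨w, by rw [hw]; simp⟩
    refine ⟨⟨(k : ℤ), by simpa using hk.ne'⟩, ?_⟩
    change (k : ℤ) • (Submodule.Quotient.mk u : Additive (𝓞 L)ˣ ⧸ LinearMap.range ψ) = _
    rw [← Submodule.Quotient.mk_smul, Submodule.Quotient.mk_eq_zero]
    refine ⟨Additive.ofMul w', ?_⟩
    rw [natCast_zsmul]
    exact congrArg Additive.ofMul hw'
  have hrk : Units.rank K = Units.rank L := by
    rw [← Units.finrank_eq K, ← Units.finrank_eq L,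
      ← Submodule.finrank_quotient_add_finrank (LinearMap.range ψ),
      Module.finrank_eq_zero_iff_isTorsion.mpr htor, zero_add, LinearMap.finrank_range_of_inj hψ]
  unfold Units.rank at hrk
  have pK : 0 < Fintype.card (InfinitePlace K) := Fintype.card_pos
  have pL : 0 < Fintype.card (InfinitePlace L) := Fintype.card_pos
  have cK := InfinitePlace.card_eq_nrRealPlaces_add_nrComplexPlaces K
  have cL := InfinitePlace.card_eq_nrRealPlaces_add_nrComplexPlaces L
  have dK := InfinitePlace.card_add_two_mul_card_eq_rank K
  have dL := InfinitePlace.card_add_two_mul_card_eq_rank L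
  have hmul := Module.finrank_mul_finrank ℚ K L
  rw [← dK, ← dL] at hmul
  rw [← nrComplexPlaces_eq_zero_iff, ← nrRealPlaces_eq_zero_iff]
  set d := Module.finrank K L
  generalize InfinitePlace.nrRealPlaces K = r at *
  generalize InfinitePlace.nrComplexPlaces K = s at *
  generalize InfinitePlace.nrRealPlaces L = r' at *
  generalize InfinitePlace.nrComplexPlaces L = s' at *
  have h1 : (r + 2 * s) * 2 ≤ (r + 2 * s) * d := Nat.mul_le_mul_left _ hd
  have hs : s = 0 := by omega
  have hr' : r' = 0 := by omega
  refine ⟨hs, hr', ?_⟩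
  subst hs hr'
  have : r * d = r * 2 := by simp at hmul; omega
  exact Nat.eq_of_mul_eq_mul_left (by omega) this

open Polynomial in
theorem deg_two {D K : Type} [DivisionRing D] [Field K] [Algebra K D] [NumberField K]
    [FiniteDimensional K D]
    (hcen : ∀ x : D, (∀ y, Commute x y) → ∃ k, algebraMap K D k = x)
    (hpow : ∀ (L : Type) [Field L] [NumberField L] (f : L →+* D) (u : (𝓞 L)ˣ),
      ∃ k : ℕ, 0 < k ∧ ∀ y : D, Commute (f ((u : 𝓞 L) : L) ^ k) y)
    (x : D) (hx : ¬ ∃ k, algebraMap K D k = x) :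
    IsTotallyReal K ∧ (minpoly K x).natDegree = 2 ∧
      ∀ (σ : K →+* ℝ) (r : ℝ), eval₂ σ r (minpoly K x) ≠ 0 := by
  have hInt : IsIntegral K x := Algebra.IsIntegral.isIntegral x
  have : Fact (Irreducible (minpoly K x)) := ⟨minpoly.irreducible hInt⟩
  have hne : minpoly K x ≠ 0 := minpoly.ne_zero hInt
  let L := AdjoinRoot (minpoly K x)
  have : Module.Finite K L := (minpoly.monic hInt).finite_adjoinRoot
  have : NumberField L := NumberField.of_module_finite K L
  let f : L →ₐ[K] D := Ideal.Quotient.liftₐ (Ideal.span {minpoly K x}) (aeval x) (by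
    intro a ha
    obtain ⟨c, rfl⟩ := Ideal.mem_span_singleton.mp ha
    rw [map_mul, minpoly.aeval, zero_mul])
  have hfr : Module.finrank K L = (minpoly K x).natDegree := by
    rw [(AdjoinRoot.powerBasis hne).finrank, AdjoinRoot.powerBasis_dim]
  have hd : 2 ≤ Module.finrank K L := by
    rw [hfr]
    exact (minpoly.two_le_natDegree_iff hInt).mpr (by rintro ⟨k, hk⟩; exact hx ⟨k, hk⟩)
  obtain ⟨h1, h2, h3⟩ := rank_lemma K L (by
    intro u
    obtain ⟨k, hk, hc⟩ := hpow L f.toRingHom u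
    obtain ⟨w, hw⟩ := hcen _ hc
    refine ⟨k, hk, w, ?_⟩
    apply f.toRingHom.injective
    rw [map_pow, ← hw]
    exact f.commutes w) hd
  refine ⟨h1, by rw [← hfr, h3], ?_⟩
  intro σ r hr
  let τ : L →+* ℝ := AdjoinRoot.lift σ r hr
  refine IsTotallyComplex.complexEmbedding_not_isReal (K := L) (Complex.ofRealHom.comp τ) ?_
  rw [ComplexEmbedding.isReal_iff]
  refine RingHom.ext fun z => ?_
  simp [ComplexEmbedding.conjugate]

open Polynomial in
theorem quad_neg {D K : Type} [DivisionRing D] [Field K] [Algebra K D] 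
    (x : D) (hInt : IsIntegral K x) (hd : (minpoly K x).natDegree = 2)
    (hr : ∀ (σ : K →+* ℝ) (r : ℝ), eval₂ σ r (minpoly K x) ≠ 0)
    (a : K) (ha : x * x = algebraMap K D a) (σ : K →+* ℝ) : σ a < 0 := by
  by_contra! h
  have h1 : minpoly K x ∣ X ^ 2 - C a := minpoly.dvd K x (by simp [pow_two, ha])
  obtain ⟨q, hq⟩ := h1
  refine hr σ √(σ a) ?_
  have hm : (X ^ 2 - C a : K[X]) = minpoly K x := by
    refine Polynomial.eq_of_monic_of_dvd_of_natDegree_le (minpoly.monic hInt)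
      (monic_X_pow_sub_C a two_ne_zero) ⟨q, hq⟩ ?_ 
    rw [hd]; exact (natDegree_X_pow_sub_C (n := 2) (r := a)).le
  rw [← hm]
  simp [Real.sq_sqrt h]

open Polynomial in
theorem quad_eq {D K : Type} [DivisionRing D] [Field K] [Algebra K D] 
    (x : D) (hInt : IsIntegral K x) (hd : (minpoly K x).natDegree = 2) :
    ∃ p q : K, x * x = algebraMap K D p * x + algebraMap K D q := by
  have h := minpoly.aeval K x
  have hm := minpoly.monic hInt
  have hc : (minpoly K x).coeff 2 = 1 := by rw [← hd]; exact hm.coeff_natDegree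
  rw [aeval_eq_sum_range, hd] at h
  simp only [Finset.sum_range_succ, Finset.sum_range_zero, hc, pow_zero, pow_one, map_one, one_mul,
    zero_add, Algebra.smul_def, mul_one] at h
  refine ⟨-(minpoly K x).coeff 1, -(minpoly K x).coeff 0, ?_⟩
  rw [map_neg, map_neg, ← pow_two, eq_comm, ← sub_eq_zero, ← neg_eq_zero, ← h]
  noncomm_ring

theorem quat_of {D K : Type} [DivisionRing D] [Field K] [CharZero K] [Algebra K D]
    (hquad : ∀ x : D, ∃ p q : K, x * x = algebraMap K D p * x + algebraMap K D q)
    (hnc : ∃ x y : D, x * y ≠ y * x) :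
    ∃ (a b : K) (i j : D), i * i = algebraMap K D a ∧ j * j = algebraMap K D b ∧
      (¬ ∃ k, algebraMap K D k = i) ∧ (¬ ∃ k, algebraMap K D k = j) ∧
      Nonempty (D ≃+* ℍ[K, a, b]) := by
  obtain ⟨x, y, hxy⟩ := hnc
  have : CharZero D := charZero_of_injective_algebraMap (algebraMap K D).injective
  have h2 : (2 : D) ≠ 0 := two_ne_zero
  have hK : ∀ (k : K) (z : D), Commute (algebraMap K D k) z := fun k z => Algebra.commutes k z
  -- complete the square
  have hsq : ∀ x : D, ∃ (s : K) (c : K), (x - algebraMap K D s) * (x - algebraMap K D s) = algebraMap K D c := by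
    intro x
    obtain ⟨p, q, hpq⟩ := hquad x
    refine ⟨p / 2, q + (p / 2) * (p / 2), ?_⟩
    have e : algebraMap K D p = algebraMap K D (p / 2) + algebraMap K D (p / 2) := by
      rw [← map_add, add_halves]
    rw [mul_sub, sub_mul, sub_mul, hpq, e, ← (hK (p / 2) x).eq, map_add, map_mul]
    noncomm_ring
  obtain ⟨s, a, ha⟩ := hsq x
  set i := x - algebraMap K D s with hi
  clear_value i
  have hiy : i * y ≠ y * i := by
    intro h
    apply hxy
    rw [hi, sub_mul, mul_sub, (hK s y).eq] at h
    simpa using h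
  have hi0 : i ≠ 0 := by rintro h; simp [h] at hiy
  have hiK : ¬ ∃ k, algebraMap K D k = i := by
    rintro ⟨k, hk⟩
    apply hiy; rw [← hk]; exact hK k y
  set j := i * y - y * i with hj
  have hj0 : j ≠ 0 := sub_ne_zero.mpr hiy
  have hij : i * j = - (j * i) := by
    rw [hj]
    have e1 : i * i * y = y * (i * i) := by rw [ha]; exact hK a y
    rw [mul_sub, sub_mul, ← mul_assoc, e1]
    noncomm_ring
  have hjK : ¬ ∃ k, algebraMap K D k = j := by
    rintro ⟨k, hk⟩
    have : i * j = j * i := by rw [← hk]; exact (hK k i).symm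
    rw [this] at hij
    have : (2 : D) * (j * i) = 0 := by rw [two_mul]; nth_rewrite 1 [hij]; simp
    simp [hj0, hi0] at this
  -- j ^ 2 in K
  obtain ⟨b, hb⟩ : ∃ b, j * j = algebraMap K D b := by
    obtain ⟨p, q, hpq⟩ := hquad j
    refine ⟨q, ?_⟩
    have e1 : i * (j * j) = (j * j) * i := by
      rw [← mul_assoc, hij, neg_mul, mul_assoc, hij]; noncomm_ring
    rw [hpq] at e1
    have e2 : algebraMap K D p * (i * j) = algebraMap K D p * (j * i) := by
      rw [mul_add, add_mul, (hK q i).eq, add_left_inj, ← mul_assoc, ← (hK p i).eq, mul_assoc,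
        mul_assoc] at e1
      exact e1
    have e3 : algebraMap K D p * (2 * (j * i)) = 0 := by
      rw [hij] at e2
      rw [two_mul, mul_add]
      nth_rewrite 1 [← e2]
      simp
    have : algebraMap K D p = 0 := by simpa [hj0, hi0] using e3
    rw [hpq, this]; simp
  -- centralizer of i
  have hcent : ∀ z : D, Commute z i → ∃ c d : K, z = algebraMap K D c + algebraMap K D d * i := by
    intro z hz
    obtain ⟨t, c, hc⟩ := hsq z
    set w := z - algebraMap K D t with hw
    have hwi : Commute w i := hz.sub_left (hK t i)
    obtain ⟨p, q, hpq⟩ := hquad (w + i)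
    have e1 : (2 * i - algebraMap K D p) * w = algebraMap K D p * i + algebraMap K D (q - c - a) := by
      rw [mul_add, add_mul, add_mul, hc, ha, hwi.eq, mul_add] at hpq
      rw [map_sub, map_sub, sub_mul, sub_eq_iff_eq_add]
      have : 2 * i * w = (algebraMap K D c + i * w + (i * w + algebraMap K D a)) - algebraMap K D c - algebraMap K D a := by
        noncomm_ring
      rw [this, hpq]
      abel
    -- rationalize
    have e2 : algebraMap K D (4 * a - p * p) * w = algebraMap K D (2 * p * a + p * (q - c - a)) +
        algebraMap K D (p * p + 2 * (q - c - a)) * i := by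
      have e3 : (2 * i + algebraMap K D p) * (2 * i - algebraMap K D p) = algebraMap K D (4 * a - p * p) := by
        rw [map_sub, map_mul, map_mul, ← ha, map_ofNat, mul_sub, add_mul, add_mul, (hK p (2 * i)).eq]
        noncomm_ring
      rw [← e3, mul_assoc, e1]
      generalize q - c - a = q'
      simp only [map_add, map_mul, map_ofNat, mul_add, add_mul]
      rw [← ha, mul_assoc 2 i (algebraMap K D p * i), ← mul_assoc i, ← (hK p i).eq, mul_assoc 2 i, ← (hK q' i).eq]
      noncomm_ring
    have hne : (4 * a - p * p) ≠ 0 := by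
      intro h0
      have : (2 * i + algebraMap K D p) * (2 * i - algebraMap K D p) = 0 := by
        rw [← map_zero (algebraMap K D), ← h0, map_sub, map_mul, map_mul, ← ha, map_ofNat, mul_sub, add_mul, add_mul, (hK p (2 * i)).eq]
        noncomm_ring
      rcases mul_eq_zero.mp this with h | h
      · apply hiK
        refine ⟨-p / 2, ?_⟩
        rw [map_div₀, map_neg, map_ofNat, div_eq_iff h2, neg_eq_iff_add_eq_zero, ← h, add_comm, mul_two, two_mul]
      · apply hiK
        refine ⟨p / 2, ?_⟩
        rw [map_div₀, map_ofNat, div_eq_iff h2, eq_comm, ← sub_eq_zero, ← h, mul_two, two_mul]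
    set N := 4 * a - p * p
    refine ⟨N⁻¹ * (2 * p * a + p * (q - c - a)) + t, N⁻¹ * (p * p + 2 * (q - c - a)), ?_⟩
    have hz' : z = w + algebraMap K D t := by rw [hw]; abel
    have hw' : w = algebraMap K D N⁻¹ * (algebraMap K D N * w) := by
      rw [← mul_assoc, ← map_mul, inv_mul_cancel₀ hne, map_one, one_mul]
    rw [hz', hw', e2]
    simp only [map_add, map_mul, mul_add, mul_assoc, add_mul]
    abel
  refine ⟨a, b, i, j, ha, hb, hiK, hjK, ?_⟩
  let B : QuaternionAlgebra.Basis D a (0 : K) b :=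
    { i := i, j := j, k := i * j
      i_mul_i := by simp [ha, Algebra.smul_def]
      j_mul_j := by simp [hb, Algebra.smul_def]
      i_mul_j := rfl
      j_mul_i := by simp [hij] }
  have hform : ∀ z, B.liftHom z = (algebraMap K D z.re + algebraMap K D z.imI * i) +
      (algebraMap K D z.imJ + algebraMap K D z.imK * i) * j := by
    intro z
    simp [QuaternionAlgebra.Basis.liftHom, QuaternionAlgebra.Basis.lift, B, Algebra.smul_def, add_mul, mul_assoc, add_assoc]
  have hindep : ∀ c d : K, algebraMap K D c + algebraMap K D d * i = 0 → c = 0 ∧ d = 0 := by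
    intro c d h
    have hd : d = 0 := by
      by_contra hd
      apply hiK
      refine ⟨-(d⁻¹ * c), ?_⟩
      have : i = algebraMap K D d⁻¹ * (algebraMap K D d * i) := by
        rw [← mul_assoc, ← map_mul, inv_mul_cancel₀ hd, map_one, one_mul]
      rw [this, (eq_neg_of_add_eq_zero_right h), map_neg, map_mul, mul_neg]
    subst hd
    simpa using h
  have hanti : ∀ c d : K, ∀ z, z = (algebraMap K D c + algebraMap K D d * i) * j → i * z = -(z * i) := by
    rintro c d z rfl
    have : i * (algebraMap K D c + algebraMap K D d * i) = (algebraMap K D c + algebraMap K D d * i) * i := by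
      rw [mul_add, add_mul, (hK c i).eq, ← mul_assoc, (hK d i).eq]
    rw [← mul_assoc, this, mul_assoc, hij, mul_neg, mul_assoc]
  have hinj : Function.Injective B.liftHom := by
    rw [injective_iff_map_eq_zero]
    intro z hz
    rw [hform] at hz
    set P := algebraMap K D z.re + algebraMap K D z.imI * i with hP
    set Q := (algebraMap K D z.imJ + algebraMap K D z.imK * i) with hQ
    have hPi : i * P = P * i := by
      rw [hP, mul_add, add_mul, (hK z.re i).eq, ← mul_assoc, (hK z.imI i).eq]
    have hQi := hanti _ _ _ (rfl : Q * j = _)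
    have hPQ : P = -(Q * j) := eq_neg_of_add_eq_zero_left hz
    have hP0 : P = 0 := by
      have : i * P = -(P * i) := by rw [hPQ, mul_neg, hQi]; noncomm_ring
      rw [hPi] at this
      have : (2 : D) * (P * i) = 0 := by rw [two_mul]; nth_rewrite 1 [this]; simp
      simpa [hi0] using this
    have hQ0 : Q = 0 := by
      rw [hP0, zero_add] at hz
      simpa [hj0] using hz
    obtain ⟨r1, r2⟩ := hindep _ _ hP0
    obtain ⟨r3, r4⟩ := hindep _ _ hQ0
    ext <;> simp [*]
  have hsurj : Function.Surjective B.liftHom := by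
    intro z
    -- split
    have hi2 : ∀ z, i * (i * z) = z * (i * i) := by intro z; rw [← mul_assoc, ha]; exact hK a z
    have hP : Commute (i * z + z * i) i := by
      change _ * _ = _ * _
      rw [mul_add, hi2, add_mul, mul_assoc, mul_assoc, add_comm]
    have hPi : Commute ((i * z + z * i) * (2 * i)⁻¹) i :=
      hP.mul_left (((Commute.ofNat_left 2 i).mul_left (Commute.refl i)).inv_left₀)
    have hM : i * (i * z - z * i) = - ((i * z - z * i) * i) := by
      rw [mul_sub, hi2, sub_mul, mul_assoc, mul_assoc]; abel
    have hMj : Commute ((i * z - z * i) * j) i := by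
      change _ * _ = _ * _
      rw [← mul_assoc, hM, neg_mul, mul_assoc, mul_assoc, hij, mul_neg, neg_neg]
    have hNi : Commute ((2 * i)⁻¹ * ((i * z - z * i) * j * (j * j)⁻¹)) i := by
      refine (((Commute.ofNat_left 2 i).mul_left (Commute.refl i)).inv_left₀).mul_left (hMj.mul_left ?_)
      rw [hb]
      exact (hK b i).inv_left₀
    have hPi' : Commute ((2 * i)⁻¹ * (i * z + z * i)) i :=
      (((Commute.ofNat_left 2 i).mul_left (Commute.refl i)).inv_left₀).mul_left hP
    obtain ⟨c, d, hcd⟩ := hcent _ hPi'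
    obtain ⟨c', d', hcd'⟩ := hcent _ hNi
    refine ⟨⟨c, d, c', d'⟩, ?_⟩
    rw [hform, ← hcd, ← hcd']
    have : (i * z - z * i) * j * (j * j)⁻¹ * j = i * z - z * i := by
      rw [mul_inv_rev]; simp [mul_assoc, hj0]
    rw [mul_assoc, this, ← mul_add]
    have : i * z + z * i + (i * z - z * i) = 2 * i * z := by noncomm_ring
    rw [this, inv_mul_cancel_left₀ (mul_ne_zero h2 hi0)]
  exact ⟨(RingEquiv.ofBijective B.liftHom ⟨hinj, hsurj⟩).symm⟩


theorem division_tdq {D : Type} [DivisionRing D] [Algebra ℚ D] [FiniteDimensional ℚ D]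
    (P : ∀ (L : Type) [Field L] [NumberField L] (f g : L →+* D) (u : (𝓞 L)ˣ),
      ∃ k : ℕ, 0 < k ∧ Commute (f ((u : 𝓞 L) : L) ^ k) (g ((u : 𝓞 L) : L) ^ k))
    (hnc : ∃ x y : D, x * y ≠ y * x) : IsTotallyDefiniteQuaternionAlgebra D := by
  have : CharZero D := algebraRat.charZero D
  let K := Subring.center D
  have hfin : FiniteDimensional ℚ K := by
    let φ : K →ₗ[ℚ] D := (Subring.center D).subtype.toAddMonoidHom.toRatLinearMap
    exact FiniteDimensional.of_injective φ Subtype.val_injective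
  have : NumberField K := { to_charZero := inferInstance, to_finiteDimensional := hfin }
  have : FiniteDimensional K D := Module.Finite.of_restrictScalars_finite ℚ K D
  have hcen : ∀ x : D, (∀ y, Commute x y) → ∃ k : K, algebraMap K D k = x := by
    intro x hx
    exact ⟨⟨x, Subring.mem_center_iff.mpr fun g => ((hx g).eq).symm⟩, rfl⟩
  have hpow := fun (L : Type) [Field L] [NumberField L] (f : L →+* D) (u : (𝓞 L)ˣ) => central_pow P L f u
  have hdeg := fun x hx => deg_two (K := K) hcen hpow x hx
  have hInt : ∀ x : D, IsIntegral K x := fun x => Algebra.IsIntegral.isIntegral x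
  have hquad : ∀ x : D, ∃ p q : K, x * x = algebraMap K D p * x + algebraMap K D q := by
    intro x
    by_cases hx : ∃ k, algebraMap K D k = x
    · obtain ⟨k, rfl⟩ := hx
      exact ⟨k, 0, by simp⟩
    · exact quad_eq x (hInt x) (hdeg x hx).2.1
  obtain ⟨a, b, i, j, ha, hb, hi, hj, e⟩ := quat_of hquad hnc
  have hreal := (hdeg i hi).1
  have nz : ∀ (x : D) (c : K), x * x = algebraMap K D c → (¬ ∃ k, algebraMap K D k = x) → c ≠ 0 := by
    rintro x c hx hk rfl
    rw [map_zero, mul_self_eq_zero] at hx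
    exact hk ⟨0, by rw [hx, map_zero]⟩
  refine ⟨K, inferInstance, inferInstance, hfin, ?_, a, b, nz i a ha hi, nz j b hb hj, ?_, e⟩
  · intro σ x
    have := IsTotallyReal.complexEmbedding_isReal σ
    rw [ComplexEmbedding.isReal_iff] at this
    have h2 := RingHom.congr_fun this x
    exact Complex.conj_eq_iff_im.mp h2
  · intro σ
    exact ⟨quad_neg i (hInt i) (hdeg i hi).2.1 (hdeg i hi).2.2 a ha σ,
      quad_neg j (hInt j) (hdeg j hj).2.1 (hdeg j hj).2.2 b hb σ⟩

theorem forward_dir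
    (n : ℕ) (A : Fin n → Type) [∀ i, Ring (A i)] [∀ i, Algebra ℚ (A i)]
    [∀ i, FiniteDimensional ℚ (A i)] (hsimple : ∀ i, IsSimpleRing (A i))
    (S : Subring (∀ i, A i)) (hS : Submodule.span ℚ (S : Set (∀ i, A i)) = ⊤)
    (h : ∃ H : Subgroup (↥S)ˣ, H.FiniteIndex ∧ ∀ x y : H, x * y = y * x) (i : Fin n) :
    (∀ x y : A i, x * y = y * x) ∨ IsTotallyDefiniteQuaternionAlgebra (A i) := by
  classical
  by_cases hcomm : ∀ x y : A i, x * y = y * x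
  · exact Or.inl hcomm
  right
  push Not at hcomm
  have := hsimple i
  have : IsArtinianRing (A i) := IsArtinianRing.of_finite ℚ (A i)
  have hsq : ∀ x y : A i, x * x = 0 → y * y = 0 → x * y = y * x := by
    intro x y hx hy
    have := sq_zero_comm S hS h (Pi.single i x) (Pi.single i y)
      (by rw [← Pi.single_mul, hx, Pi.single_zero]) (by rw [← Pi.single_mul, hy, Pi.single_zero])
    rw [← Pi.single_mul, ← Pi.single_mul] at this
    exact Pi.single_injective i this
  obtain ⟨r, hr, E, hE, ⟨e⟩⟩ := IsSimpleRing.exists_ringEquiv_matrix_divisionRing (A i)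
  have hr1 : r = 1 := by
    by_contra hne
    have hr0 : r ≠ 0 := hr.out
    have h2 : 1 < r := by omega
    let p : Fin r := ⟨0, by omega⟩
    let q : Fin r := ⟨1, h2⟩
    have hpq : p ≠ q := by simp [p, q]
    have := hsq (e.symm (Matrix.single p q 1)) (e.symm (Matrix.single q p 1))
      (by rw [← map_mul, Matrix.single_mul_single_of_ne _ _ _ _ hpq.symm, map_zero])
      (by rw [← map_mul, Matrix.single_mul_single_of_ne _ _ _ _ hpq, map_zero])
    rw [← map_mul, ← map_mul] at this
    have := e.symm.injective this
    rw [Matrix.single_mul_single_same, Matrix.single_mul_single_same] at this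
    have := congrFun (congrFun this p) p
    simp [Matrix.single, hpq.symm] at this
  subst hr1
  let e' : A i ≃+* E := e.trans Matrix.uniqueRingEquiv
  have hunit : ∀ x : A i, IsUnit x ∨ x = 0 := by
    intro x
    by_cases hx : x = 0
    · exact Or.inr hx
    · left
      have : IsUnit (e' x) := isUnit_iff_ne_zero.mpr (by simpa using hx)
      simpa using this
  have hden := den S hS
  let _ : DivisionRing (A i) := DivisionRing.ofIsUnitOrEqZero hunit
  refine division_tdq ?_ hcomm
  intro L _ _ f g u
  obtain ⟨k1, hk1, w1, hw1⟩ := unit_pow_mem A S hden i L f u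
  obtain ⟨k2, hk2, w2, hw2⟩ := unit_pow_mem A S hden i L g u
  obtain ⟨k3, hk3, hc⟩ := pow_comm_of_virt h (w1 ^ k2) (w2 ^ k1)
  refine ⟨k1 * (k2 * k3), by positivity, ?_⟩
  have hc' := congrFun (congrArg (fun w : (↥S)ˣ => ((w : S) : ∀ i, A i)) hc.eq) i
  simp only [← pow_mul, Units.val_mul, Units.val_pow_eq_pow_val, Subring.coe_mul, Subring.coe_pow,
    Pi.mul_apply, Pi.pow_apply] at hc'
  rw [hw1, hw2, ← pow_mul, ← pow_mul] at hc'
  rw [show k2 * (k1 * k3) = k1 * (k2 * k3) by ring] at hc'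
  exact hc'

theorem common_den {B K : Type} [AddCommGroup B] [Field K] [NumberField K] (S : AddSubgroup B)
    (hS : S.FG) (c : B →+ K) : ∃ d : ℤ, d ≠ 0 ∧ ∀ s ∈ S, IsIntegral ℤ ((d : K) * c s) := by
  classical
  obtain ⟨T, hT⟩ := hS
  have hex : ∀ x : K, ∃ m : ℤ, m ≠ 0 ∧ IsIntegral ℤ ((m : K) * x) := by
    intro x
    obtain ⟨m, hm, hx⟩ := IsAlgebraic.exists_integral_multiple (R := ℤ)
      ((IsFractionRing.isAlgebraic_iff ℤ ℚ K).mpr (Algebra.IsAlgebraic.isAlgebraic (R := ℚ) x))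
    exact ⟨m, hm, by simpa using hx⟩
  choose m hm hmi using hex
  refine ⟨∏ t ∈ T, m (c t), Finset.prod_ne_zero_iff.mpr fun t _ => hm _, ?_⟩
  intro s hs
  rw [← hT] at hs
  induction hs using AddSubgroup.closure_induction with
  | mem t ht =>
    rw [← Finset.prod_erase_mul T _ ht, Int.cast_mul, mul_assoc]
    exact (isIntegral_algebraMap (R := ℤ) (A := K) (x := ∏ x ∈ T.erase t, m (c x))).mul (hmi (c t))
  | zero => simpa using isIntegral_zero
  | add x y _ _ hx hy => rw [map_add, mul_add]; exact hx.add hy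
  | neg x _ hx => rw [map_neg, mul_neg]; exact hx.neg

theorem finite_bdd {K : Type} [Field K] [NumberField K]
    (hreal : ∀ σ : K →+* ℂ, ∀ x : K, (σ x).im = 0) (d : ℤ) (hd : d ≠ 0) (B : (K →+* ℝ) → ℝ) :
    {x : K | IsIntegral ℤ ((d : K) * x) ∧ ∀ σ : K →+* ℝ, σ x * σ x ≤ B σ}.Finite := by
  have hex : ∀ φ : K →+* ℂ, ∃ σ : K →+* ℝ, ∀ x, φ x = (σ x : ℂ) := by
    intro φ
    have hr : ComplexEmbedding.IsReal φ := by
      rw [ComplexEmbedding.isReal_iff]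
      refine RingHom.ext fun x => ?_
      exact Complex.conj_eq_iff_im.mpr (hreal φ x)
    exact ⟨hr.embedding, fun x => (hr.coe_embedding_apply x).symm⟩
  choose r hr using hex
  let C : ℝ := ∑ φ : K →+* ℂ, |(d : ℝ)| * √(B (r φ))
  have hfin := Embeddings.finite_of_norm_le K ℂ C
  refine Set.Finite.subset (hfin.preimage (f := fun x : K => (d : K) * x) ?_) ?_
  · intro x _ y _ hxy
    exact mul_left_cancel₀ (by exact_mod_cast hd) hxy
  · rintro x ⟨hx1, hx2⟩
    refine ⟨hx1, fun φ => ?_⟩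
    have h1 : ‖φ ((d : K) * x)‖ = |(d : ℝ)| * |r φ x| := by
      rw [map_mul, map_intCast, norm_mul, hr φ x, Complex.norm_real, Complex.norm_intCast, Real.norm_eq_abs]
    have h2 : |r φ x| ≤ √(B (r φ)) := by
      apply Real.abs_le_sqrt
      rw [pow_two]; exact hx2 _
    rw [h1]
    refine (mul_le_mul_of_nonneg_left h2 (abs_nonneg _)).trans ?_
    exact Finset.single_le_sum (f := fun φ : K →+* ℂ => |(d : ℝ)| * √(B (r φ)))
      (fun φ _ => by positivity) (Finset.mem_univ φ)

/-- reduced norm -/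
def qN {K : Type} [Field K] {a b : K} (q : ℍ[K, a, b]) : K :=
  q.re * q.re - a * (q.imI * q.imI) - b * (q.imJ * q.imJ) + a * b * (q.imK * q.imK)

theorem qN_mul {K : Type} [Field K] {a b : K} (p q : ℍ[K, a, b]) : qN (p * q) = qN p * qN q := by
  simp [qN]
  ring

theorem finite_conj_tdq {B C : Type} [Ring B] [AddCommGroup C] (hB : IsTotallyDefiniteQuaternionAlgebra B)
    (S : AddSubgroup C) (hS : S.FG) (c : C →+ B) (x : B) :
    {y : B | (∃ s ∈ S, c s = y) ∧ ∃ u : Bˣ, y = u * x * (u⁻¹ : Bˣ)}.Finite := by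
  obtain ⟨K, _, _, hfd, hreal, a, b, ha, hb, hneg, ⟨e⟩⟩ := hB
  have : NumberField K := { to_charZero := algebraRat.charZero K, to_finiteDimensional := by
                                    convert hfd
                                    exact Subsingleton.elim _ _ }
  let c0 : ℍ[K, a, b] →+ K := { toFun := fun q => q.re, map_zero' := rfl, map_add' := fun _ _ => rfl }
  let c1 : ℍ[K, a, b] →+ K := { toFun := fun q => q.imI, map_zero' := rfl, map_add' := fun _ _ => rfl }
  let c2 : ℍ[K, a, b] →+ K := { toFun := fun q => q.imJ, map_zero' := rfl, map_add' := fun _ _ => rfl }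
  let c3 : ℍ[K, a, b] →+ K := { toFun := fun q => q.imK, map_zero' := rfl, map_add' := fun _ _ => rfl }
  let ec : C →+ ℍ[K, a, b] := e.toRingHom.toAddMonoidHom.comp c
  obtain ⟨d0, hd0, h0⟩ := common_den S hS (c0.comp ec)
  obtain ⟨d1, hd1, h1⟩ := common_den S hS (c1.comp ec)
  obtain ⟨d2, hd2, h2⟩ := common_den S hS (c2.comp ec)
  obtain ⟨d3, hd3, h3⟩ := common_den S hS (c3.comp ec)
  let M := qN (e x)
  have f0 := finite_bdd hreal d0 hd0 (fun σ => σ M)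
  have f1 := finite_bdd hreal d1 hd1 (fun σ => σ M / (-σ a))
  have f2 := finite_bdd hreal d2 hd2 (fun σ => σ M / (-σ b))
  have f3 := finite_bdd hreal d3 hd3 (fun σ => σ M / (σ a * σ b))
  have hfin := (f0.prod (f1.prod (f2.prod f3))).preimage
    (f := fun y : B => ((e y).re, (e y).imI, (e y).imJ, (e y).imK)) (by
      intro y _ z _ hyz
      simp only [Prod.mk.injEq] at hyz
      apply e.injective
      ext <;> tauto)
  refine hfin.subset ?_
  rintro y ⟨⟨s, hs, rfl⟩, u, hu⟩
  have hM : qN (e (c s)) = M := by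
    rw [hu, map_mul, map_mul, qN_mul, qN_mul, mul_right_comm, ← qN_mul, ← map_mul, Units.mul_inv]
    simp [qN, M]
  have hσ : ∀ σ : K →+* ℝ, σ M = σ (e (c s)).re * σ (e (c s)).re +
      (-σ a) * (σ (e (c s)).imI * σ (e (c s)).imI) + (-σ b) * (σ (e (c s)).imJ * σ (e (c s)).imJ)
      + (σ a * σ b) * (σ (e (c s)).imK * σ (e (c s)).imK) := by
    intro σ
    rw [← hM]
    simp only [qN, map_add, map_sub, map_mul]
    ring
  have pos : ∀ σ : K →+* ℝ, 0 < -σ a ∧ 0 < -σ b ∧ 0 < σ a * σ b := fun σ =>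
    ⟨neg_pos.mpr (hneg σ).1, neg_pos.mpr (hneg σ).2, mul_pos_of_neg_of_neg (hneg σ).1 (hneg σ).2⟩
  have nn : ∀ σ : K →+* ℝ, 0 ≤ σ (e (c s)).re * σ (e (c s)).re ∧
      0 ≤ (-σ a) * (σ (e (c s)).imI * σ (e (c s)).imI) ∧
      0 ≤ (-σ b) * (σ (e (c s)).imJ * σ (e (c s)).imJ) ∧
      0 ≤ (σ a * σ b) * (σ (e (c s)).imK * σ (e (c s)).imK) := fun σ =>
    ⟨mul_self_nonneg _, mul_nonneg (pos σ).1.le (mul_self_nonneg _),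
      mul_nonneg (pos σ).2.1.le (mul_self_nonneg _), mul_nonneg (pos σ).2.2.le (mul_self_nonneg _)⟩
  refine ⟨⟨h0 s hs, fun σ => ?_⟩, ⟨h1 s hs, fun σ => ?_⟩, ⟨h2 s hs, fun σ => ?_⟩, ⟨h3 s hs, fun σ => ?_⟩⟩
  · obtain ⟨n0, n1, n2, n3⟩ := nn σ
    have := hσ σ
    dsimp only
    linarith
  · obtain ⟨n0, n1, n2, n3⟩ := nn σ
    have := hσ σ
    dsimp only
    rw [le_div_iff₀' (pos σ).1]
    linarith
  · obtain ⟨n0, n1, n2, n3⟩ := nn σ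
    have := hσ σ
    dsimp only
    rw [le_div_iff₀' (pos σ).2.1]
    linarith
  · obtain ⟨n0, n1, n2, n3⟩ := nn σ
    have := hσ σ
    dsimp only
    rw [le_div_iff₀' (pos σ).2.2]
    linarith

theorem backward_dir
    (n : ℕ) (A : Fin n → Type) [∀ i, Ring (A i)]
    (S : Subring (∀ i, A i)) (hS : S.toAddSubgroup.FG)
    (h : ∀ i, (∀ x y : A i, x * y = y * x) ∨ IsTotallyDefiniteQuaternionAlgebra (A i)) :
    ∃ H : Subgroup (↥S)ˣ, H.FiniteIndex ∧ ∀ x y : H, x * y = y * x := by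
  classical
  refine ⟨Subgroup.center _, ?_, fun x y => Subtype.ext (Subgroup.mem_center_iff.mp y.2 x)⟩
  obtain ⟨T, hT⟩ := id hS
  let F : (↥S)ˣ → T → ∀ i, A i := fun u t i =>
    ((u : S) : ∀ i, A i) i * t.1 i * (((u⁻¹ : (↥S)ˣ) : S) : ∀ i, A i) i
  have hTS : ∀ t : T, t.1 ∈ S := by
    intro t
    have : t.1 ∈ S.toAddSubgroup := hT ▸ AddSubgroup.subset_closure t.2
    exact this
  have hfin : (Set.range F).Finite := by
    have hloc : ∀ (t : T) (i : Fin n), (Set.range fun u => F u t i).Finite := by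
      intro t i
      rcases h i with hc | hq
      · refine (Set.finite_singleton (t.1 i)).subset ?_
        rintro _ ⟨u, rfl⟩
        change _ * _ * _ = _
        rw [hc _ (t.1 i), mul_assoc, ← Pi.mul_apply, ← Subring.coe_mul, Units.mul_inv]
        simp
      · refine (finite_conj_tdq hq S.toAddSubgroup hS (Pi.evalAddMonoidHom A i) (t.1 i)).subset ?_
        rintro _ ⟨u, rfl⟩
        refine ⟨⟨F u t, ?_, rfl⟩, Units.map ((Pi.evalRingHom A i).comp S.subtype).toMonoidHom u, rfl⟩
        exact S.mul_mem (S.mul_mem (u : S).2 (hTS t)) (((u⁻¹ : (↥S)ˣ) : S)).2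
    refine (Set.Finite.pi fun t => Set.Finite.pi fun i => hloc t i).subset ?_
    rintro _ ⟨u, rfl⟩
    intro t _ i _
    exact ⟨u, rfl⟩
  have key : ∀ u v, F u = F v → u⁻¹ * v ∈ Subgroup.center (↥S)ˣ := by
    intro u v huv
    have hcomm : ∀ t ∈ S.toAddSubgroup,
        (((u⁻¹ * v : (↥S)ˣ) : S) : ∀ i, A i) * t = t * (((u⁻¹ * v : (↥S)ˣ) : S) : ∀ i, A i) := by
      intro t ht
      rw [← hT] at ht
      induction ht using AddSubgroup.closure_induction with
      | mem t ht =>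
        have h1 : ((u : S) : ∀ i, A i) * t * (((u⁻¹ : (↥S)ˣ) : S) : ∀ i, A i) =
            ((v : S) : ∀ i, A i) * t * (((v⁻¹ : (↥S)ˣ) : S) : ∀ i, A i) := congrFun huv ⟨t, ht⟩
        have c1 : (((u⁻¹ : (↥S)ˣ) : S) : ∀ i, A i) * ((u : S) : ∀ i, A i) = 1 := by
          rw [← Subring.coe_mul, Units.inv_mul, Subring.coe_one]
        have c2 : (((v⁻¹ : (↥S)ˣ) : S) : ∀ i, A i) * ((v : S) : ∀ i, A i) = 1 := by
          rw [← Subring.coe_mul, Units.inv_mul, Subring.coe_one]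
        rw [Units.val_mul, Subring.coe_mul]
        generalize (((u⁻¹ : (↥S)ˣ) : S) : ∀ i, A i) = u' at *
        generalize (((v⁻¹ : (↥S)ˣ) : S) : ∀ i, A i) = v' at *
        generalize ((u : S) : ∀ i, A i) = U at *
        generalize ((v : S) : ∀ i, A i) = V at *
        calc u' * V * t = u' * (V * t * v') * V := by simp only [mul_assoc, c2, mul_one]
          _ = u' * (U * t * u') * V := by rw [h1]
          _ = (u' * U) * t * (u' * V) := by simp only [mul_assoc]
          _ = _ := by rw [c1, one_mul]
      | zero => simp
      | add x y _ _ hx hy => rw [mul_add, add_mul, hx, hy]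
      | neg x _ hx => rw [mul_neg, neg_mul, hx]
    rw [Subgroup.mem_center_iff]
    intro g
    ext1; ext1
    exact (hcomm _ (g : S).2).symm
  rw [Subgroup.finiteIndex_iff_finite_quotient]
  have : Finite (Set.range F) := hfin
  refine Finite.of_surjective
    (fun r : Set.range F => (QuotientGroup.mk (Classical.choose r.2) : (↥S)ˣ ⧸ Subgroup.center (↥S)ˣ)) ?_
  intro q
  obtain ⟨g, rfl⟩ := QuotientGroup.mk_surjective q
  refine ⟨⟨F g, g, rfl⟩, ?_⟩
  rw [QuotientGroup.eq]
  exact key _ _ (Classical.choose_spec (⟨g, rfl⟩ : ∃ y, F y = F g))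

/-- Let `A₁, …, Aₙ` be finite-dimensional simple `ℚ`-algebras and
`S` an order in `A = A₁ × ⋯ × Aₙ`. Then `Sˣ` is virtually abelian iff each `Aᵢ` is
either commutative (a number field) or a totally definite quaternion algebra. -/
theorem units_of_order_virtually_abelian_iff
    (n : ℕ) (A : Fin n → Type) [∀ i, Ring (A i)] [∀ i, Algebra ℚ (A i)]
    [∀ i, FiniteDimensional ℚ (A i)] (hsimple : ∀ i, IsSimpleRing (A i))
    (S : Subring (∀ i, A i)) (hS : IsOrderIn S) :
    (∃ H : Subgroup (↥S)ˣ, H.FiniteIndex ∧ ∀ x y : H, x * y = y * x) ↔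
      ∀ i, (∀ x y : A i, x * y = y * x) ∨ IsTotallyDefiniteQuaternionAlgebra (A i) := by
  exact ⟨fun h i => forward_dir n A hsimple S hS.2 h i, fun h => backward_dir n A S hS.1 h⟩
end
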